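/- arXiv:1611.09156 — 3 statements merged into one kernel-verified Lean document; each statement's English description precedes it below -/
import Mathlib

section
/- Let p be a real polynomial of degree n ≥ 1 with positive leading coefficient, and let R(z) = (−1)^n p(−z)/p(z). Then p is self-interlacing of kind I if and only if (i) p(z) and p(−z) have no common complex root (so that R has exactly n poles), and (ii) Im R(z) < 0 for every complex z with Im z > 0 and p(z) ≠ 0, i.e., R maps the open upper half-plane into the open lower half-plane. -/
open Polynomial

/-- A real polynomial `p` is *self-interlacing of kind I* if all of its `natDegree` roots
are real and simple and, listed in order of decreasing absolute value `λ₀, λ₁, …`,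
they satisfy `λ₀ > -λ₁ > λ₂ > -λ₃ > ⋯ > 0`, i.e. the sequence `(-1)^i * λᵢ` is
strictly decreasing and positive. -/
def SelfInterlacingI (p : Polynomial ℝ) : Prop :=
  ∃ lam : Fin p.natDegree → ℝ,
    (p = Polynomial.C p.leadingCoeff *
        ∏ i : Fin p.natDegree, (Polynomial.X - Polynomial.C (lam i))) ∧
    StrictAnti (fun i : Fin p.natDegree => (-1 : ℝ) ^ (i : ℕ) * lam i) ∧
    ∀ i : Fin p.natDegree, 0 < (-1 : ℝ) ^ (i : ℕ) * lam i

open Filter Topology in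
lemma im_leading_nonneg {P r Q : ℂ[X]} {z₀ w : ℂ} {m : ℕ}
    (hP : P = (X - C z₀) ^ m * r) (hQ : Q.eval z₀ ≠ 0)
    (H : ∀ z : ℂ, 0 < z.im → P.eval z ≠ 0 → (Q.eval z / P.eval z).im < 0)
    (hw : ∀ᶠ t : ℝ in 𝓝[>] 0, 0 < (z₀ + t * w).im) :
    0 ≤ (w ^ m * r.eval z₀ / Q.eval z₀).im := by
  have hcont : Tendsto (fun t : ℝ => (w ^ m * r.eval (z₀ + t * w) / Q.eval (z₀ + t * w)).im)
      (𝓝[>] 0) (𝓝 (w ^ m * r.eval z₀ / Q.eval z₀).im) := by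
    have : ContinuousAt
        (fun t : ℝ => (w ^ m * r.eval (z₀ + t * w) / Q.eval (z₀ + t * w)).im) 0 := by
      refine Complex.continuous_im.continuousAt.comp (ContinuousAt.div ?_ ?_ (by simpa using hQ))
      · exact (continuous_const.mul (r.continuous.comp (by fun_prop))).continuousAt
      · exact (Q.continuous.comp (by fun_prop)).continuousAt
    simpa using this.tendsto.mono_left nhdsWithin_le_nhds
  refine ge_of_tendsto hcont ?_
  filter_upwards [hw, self_mem_nhdsWithin] with t ht ht0
  have ht0 : (0 : ℝ) < t := ht0
  have hle : 0 ≤ (P.eval (z₀ + t * w) / Q.eval (z₀ + t * w)).im := by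
    by_cases h0 : P.eval (z₀ + t * w) = 0
    · simp [h0]
    · have h := H _ ht h0
      rw [← inv_div, Complex.inv_im]
      exact div_nonneg (by linarith) (Complex.normSq_nonneg _)
  have hPt : P.eval (z₀ + t * w) / Q.eval (z₀ + t * w) =
      ((t ^ m : ℝ) : ℂ) * (w ^ m * r.eval (z₀ + t * w) / Q.eval (z₀ + t * w)) := by
    rw [hP]
    simp [mul_pow]
    ring
  rw [hPt, Complex.im_ofReal_mul] at hle
  exact nonneg_of_mul_nonneg_right hle (pow_pos ht0 m)

lemma exists_eq_pow_mul_and_eval_ne_zero {K : Type*} [Field K] {P : K[X]} (hP : P ≠ 0) {a : K} (ha : P.eval a = 0) :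
    ∃ (m : ℕ) (r : K[X]), m ≠ 0 ∧ P = (X - C a) ^ m * r ∧ r.eval a ≠ 0 := by
  obtain ⟨r, hr, hd⟩ := exists_eq_pow_rootMultiplicity_mul_and_not_dvd P hP a
  refine ⟨_, r, ?_, hr, fun h => hd (dvd_iff_isRoot.mpr h)⟩
  exact ((rootMultiplicity_pos hP).mpr ha).ne'

open Filter Topology in
lemma eval_ne_zero_of_maps_upper_to_lower {P Q : ℂ[X]} (hP : P ≠ 0)
    (hPQ : ∀ z, P.eval z = 0 → Q.eval z ≠ 0)
    (H : ∀ z : ℂ, 0 < z.im → P.eval z ≠ 0 → (Q.eval z / P.eval z).im < 0)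
    {z : ℂ} (hz : 0 < z.im) : P.eval z ≠ 0 := by
  intro h0
  obtain ⟨m, r, hm, hr, hrz⟩ := exists_eq_pow_mul_and_eval_ne_zero hP h0
  have hQ := hPQ z h0
  obtain ⟨w, hw⟩ := IsAlgClosed.exists_pow_nat_eq (-Complex.I * Q.eval z / r.eval z)
    (Nat.pos_of_ne_zero hm)
  have hev : ∀ᶠ t : ℝ in 𝓝[>] 0, 0 < (z + t * w).im := by
    have : ContinuousAt (fun t : ℝ => (z + t * w).im) 0 := by fun_prop
    exact (this.tendsto.mono_left nhdsWithin_le_nhds).eventually (lt_mem_nhds (by simpa using hz))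
  have := im_leading_nonneg hr hQ H hev
  rw [hw] at this
  have e : -Complex.I * Q.eval z / r.eval z * r.eval z / Q.eval z = -Complex.I := by
    field_simp
  rw [e] at this
  norm_num at this

open Filter Topology in
lemma derivative_mul_pos_of_maps_upper_to_lower {p q : ℝ[X]} (hp : p ≠ 0)
    (H : ∀ z : ℂ, 0 < z.im → aeval z p ≠ 0 → (aeval z q / aeval z p).im < 0)
    {a : ℝ} (ha : p.eval a = 0) (hq : q.eval a ≠ 0) :
    0 < p.derivative.eval a * q.eval a := by
  obtain ⟨m, r, hm, hr, hra⟩ := exists_eq_pow_mul_and_eval_ne_zero hp ha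
  have key : ∀ w : ℂ, 0 < w.im → 0 ≤ (w ^ m).im * (r.eval a / q.eval a) := by
    intro w hw
    have := im_leading_nonneg (P := p.map (algebraMap ℝ ℂ)) (Q := q.map (algebraMap ℝ ℂ))
      (r := r.map (algebraMap ℝ ℂ)) (z₀ := (a : ℂ)) (w := w) (m := m)
      (by conv_lhs => rw [hr]
          simp)
      (by rw [eval_map_algebraMap]
          exact (aeval_algebraMap_apply ℂ a q).trans_ne (by simpa using hq))
      (by simpa only [eval_map_algebraMap] using H)
      (by filter_upwards [self_mem_nhdsWithin] with t ht
          have ht : (0 : ℝ) < t := ht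
          simpa using mul_pos ht hw)
    have e : ∀ f : ℝ[X], (f.map (algebraMap ℝ ℂ)).eval (a : ℂ) = ((f.eval a : ℝ) : ℂ) := by
      intro f
      rw [eval_map_algebraMap]
      exact aeval_algebraMap_apply_eq_algebraMap_eval a f
    rw [e, e, mul_div_assoc, ← Complex.ofReal_div, mul_comm, Complex.im_ofReal_mul] at this
    rwa [mul_comm]
  have hexp : ∀ k : ℕ, Complex.exp (((k * Real.pi / (2 * m) : ℝ) : ℂ) * Complex.I) ^ m =
      Complex.exp (((k * Real.pi / 2 : ℝ) : ℂ) * Complex.I) := by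
    intro k
    rw [← Complex.exp_nat_mul]
    congr 1
    have : (m : ℂ) ≠ 0 := by exact_mod_cast hm
    push_cast
    field_simp
  have hG : r.eval a / q.eval a ≠ 0 := div_ne_zero hra hq
  have hm1 : (1 : ℝ) ≤ m := by exact_mod_cast Nat.one_le_iff_ne_zero.mpr hm
  have hpos : 0 < r.eval a / q.eval a := by
    have h1 := key (Complex.exp (((1 : ℕ) * Real.pi / (2 * m) : ℝ) * Complex.I)) (by
      rw [Complex.exp_ofReal_mul_I_im]
      apply Real.sin_pos_of_pos_of_lt_pi
      · have := Real.pi_pos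
        positivity
      · rw [div_lt_iff₀ (by positivity)]
        push_cast
        nlinarith [Real.pi_pos])
    rw [hexp, Complex.exp_ofReal_mul_I_im] at h1
    simp only [Nat.cast_one, one_mul, Real.sin_pi_div_two] at h1
    exact lt_of_le_of_ne h1 hG.symm
  have hm2 : m = 1 := by
    by_contra hne
    have hm2 : (2 : ℝ) ≤ m := by
      have : 2 ≤ m := by omega
      exact_mod_cast this
    have h1 := key (Complex.exp (((3 : ℕ) * Real.pi / (2 * m) : ℝ) * Complex.I)) (by
      rw [Complex.exp_ofReal_mul_I_im]
      apply Real.sin_pos_of_pos_of_lt_pi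
      · have := Real.pi_pos
        positivity
      · rw [div_lt_iff₀ (by positivity)]
        push_cast
        nlinarith [Real.pi_pos])
    rw [hexp, Complex.exp_ofReal_mul_I_im] at h1
    have e : ((3 : ℕ) * Real.pi / 2 : ℝ) = Real.pi / 2 + Real.pi := by push_cast; ring
    rw [e, Real.sin_add_pi, Real.sin_pi_div_two] at h1
    linarith
  subst hm2
  have hd : p.derivative.eval a = r.eval a := by
    rw [hr]
    simp
  rw [hd]
  rcases div_pos_iff.mp hpos with h | h
  · exact mul_pos h.1 h.2
  · exact mul_pos_of_neg_of_neg h.1 h.2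

lemma neg_one_pow_mul_prod_sq_sub_sq_pos {n : ℕ} {x : Fin n → ℝ}
    (hx : StrictAnti fun i => |x i|) (i : Fin n) :
    0 < (-1 : ℝ) ^ (i : ℕ) * ∏ j ∈ Finset.univ.erase i, (x i ^ 2 - x j ^ 2) := by
  have hs : (-1 : ℝ) ^ (i : ℕ) = ∏ j ∈ Finset.univ.erase i, if j < i then (-1 : ℝ) else 1 := by
    rw [← Finset.prod_filter, Finset.prod_const]
    congr 1
    rw [← Fin.card_Iio i]
    congr 1
    ext j
    simp only [Finset.mem_Iio, Finset.mem_filter, Finset.mem_erase, Finset.mem_univ, and_true]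
    exact ⟨fun h => ⟨h.ne, h⟩, fun h => h.2⟩
  rw [hs, ← Finset.prod_mul_distrib]
  refine Finset.prod_pos fun j hj => ?_
  rcases lt_or_gt_of_ne (Finset.ne_of_mem_erase hj) with h | h
  · have := sq_lt_sq.mpr (hx h)
    simp only [h, if_true]
    linarith
  · have := sq_lt_sq.mpr (hx h)
    simp only [h.not_gt, if_false]
    linarith

lemma prod_add_eq_two_mul_prod_erase {n : ℕ} (x : Fin n → ℝ) (i : Fin n) :
    ∏ j, (x i + x j) = 2 * x i * ∏ j ∈ Finset.univ.erase i, (x i + x j) := by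
  rw [← Finset.mul_prod_erase _ _ (Finset.mem_univ i), two_mul]

lemma prod_div_prod_im_neg {n : ℕ} (hn : 0 < n) {x : Fin n → ℝ}
    (hx : ∀ i, 0 < x i * ∏ j ∈ Finset.univ.erase i, (x i ^ 2 - x j ^ 2))
    {z : ℂ} (hz : 0 < z.im) :
    ((∏ i, (z + x i)) / ∏ i, (z - x i)).im < 0 := by
  have hne : ∀ i j, i ≠ j → x i ^ 2 - x j ^ 2 ≠ 0 := by
    intro i j hij h
    have := hx i
    rw [Finset.prod_eq_zero (Finset.mem_erase.mpr ⟨hij.symm, Finset.mem_univ j⟩) h] at this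
    simp at this
  have hinj : Function.Injective fun i => (x i : ℂ) := by
    intro i j hij
    by_contra h
    refine hne i j h ?_
    have : x i = x j := Complex.ofReal_injective hij
    rw [this, sub_self]
  have hzx : ∀ i, z - x i ≠ 0 := by
    intro i h
    have := congrArg Complex.im h
    simp at this
    exact hz.ne' this
  have hden : ∏ i, (z - x i) ≠ 0 := Finset.prod_ne_zero_iff.mpr fun i _ => hzx i
  let v : Fin n → ℂ := fun i => (x i : ℂ)
  let F : ℂ[X] := ∏ i, (X + C (v i)) - Lagrange.nodal Finset.univ v
  have hM : (∏ i, (X + C (v i))).Monic := monic_prod_of_monic _ _ fun i _ => monic_X_add_C _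
  have hdeg : F.degree < (Finset.univ : Finset (Fin n)).card := by
    have hd : (∏ i, (X + C (v i))).degree = (Lagrange.nodal Finset.univ v).degree := by
      rw [degree_prod_of_monic _ _ fun i _ => monic_X_add_C _, Lagrange.degree_nodal]
      simp
    have := degree_sub_lt_right hd Lagrange.nodal_ne_zero
      (hM.leadingCoeff.trans Lagrange.nodal_monic.leadingCoeff.symm)
    rwa [Lagrange.degree_nodal] at this
  have hF := Lagrange.eq_interpolate_of_eval_eq (s := Finset.univ) (v := v)
    (r := fun i => ∏ j, (v i + v j)) hinj.injOn hdeg (fun i _ => by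
      simp [F, eval_prod, Lagrange.eval_nodal_at_node (Finset.mem_univ i)])
  have hFz := congrArg (eval z) hF
  rw [Lagrange.eval_interpolate_not_at_node _ fun i _ => sub_ne_zero.mp (hzx i),
    Lagrange.eval_nodal] at hFz
  simp only [F, eval_sub, eval_prod, eval_add, eval_X, eval_C, Lagrange.eval_nodal,
    Lagrange.nodalWeight] at hFz
  have hR : (∏ i, (z + x i)) / ∏ i, (z - x i) = 1 + ∑ i, (((∏ j ∈ Finset.univ.erase i,
      (x i - x j)⁻¹) * ∏ j, (x i + x j) : ℝ) : ℂ) * (z - x i)⁻¹ := by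
    rw [div_eq_iff hden, add_mul, one_mul, mul_comm (Finset.sum _ _), ← sub_eq_iff_eq_add', hFz]
    congr 1
    refine Finset.sum_congr rfl fun i _ => ?_
    push_cast
    ring
  rw [hR, Complex.add_im, Complex.one_im, zero_add, Complex.im_sum]
  have : Nonempty (Fin n) := ⟨⟨0, hn⟩⟩
  refine Finset.sum_neg (fun i _ => ?_) Finset.univ_nonempty
  rw [Complex.im_ofReal_mul, Complex.inv_im]
  refine mul_neg_of_pos_of_neg ?_ (div_neg_of_neg_of_pos (by simpa using hz)
    (Complex.normSq_pos.mpr (hzx i)))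
  have hD : ∏ j ∈ Finset.univ.erase i, (x i - x j) ≠ 0 := by
    refine Finset.prod_ne_zero_iff.mpr fun j hj h => hne i j (Finset.ne_of_mem_erase hj).symm ?_
    rw [sq_sub_sq, h, mul_zero]
  have hmul := hx i
  simp only [sq_sub_sq] at hmul
  rw [Finset.prod_mul_distrib] at hmul
  rw [prod_add_eq_two_mul_prod_erase, Finset.prod_inv_distrib, inv_mul_eq_div,
    ← mul_div_mul_right _ _ hD]
  refine div_pos ?_ (mul_self_pos.mpr hD)
  linarith

lemma aeval_C_mul_prod {n : ℕ} (a : ℝ) (x : Fin n → ℝ) (z : ℂ) :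
    aeval z (C a * ∏ i, (X - C (x i))) = a * ∏ i, (z - x i) := by
  simp [map_prod]

lemma neg_one_pow_mul_aeval_neg_C_mul_prod {n : ℕ} (a : ℝ) (x : Fin n → ℝ) (z : ℂ) :
    (-1) ^ n * aeval (-z) (C a * ∏ i, (X - C (x i))) = a * ∏ i, (z + x i) := by
  rw [aeval_C_mul_prod, mul_left_comm]
  congr 1
  have : ((-1 : ℂ)) ^ n = ∏ _i : Fin n, (-1 : ℂ) := by simp
  rw [this, ← Finset.prod_mul_distrib]
  exact Finset.prod_congr rfl fun i _ => by ring

lemma splits_of_maps_upper_to_lower {p q : ℝ[X]} (hp : p ≠ 0)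
    (hpq : ∀ z : ℂ, aeval z p = 0 → aeval z q ≠ 0)
    (H : ∀ z : ℂ, 0 < z.im → aeval z p ≠ 0 → (aeval z q / aeval z p).im < 0) :
    p.Splits := by
  have hup : ∀ z : ℂ, 0 < z.im → aeval z p ≠ 0 := by
    intro z hz
    have := eval_ne_zero_of_maps_upper_to_lower (P := p.map (algebraMap ℝ ℂ))
      (Q := q.map (algebraMap ℝ ℂ)) (Polynomial.map_ne_zero hp)
      (by simpa only [eval_map_algebraMap] using hpq)
      (by simpa only [eval_map_algebraMap] using H) hz
    rwa [eval_map_algebraMap] at this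
  refine Splits.of_splits_map (algebraMap ℝ ℂ) (IsAlgClosed.splits _) fun z hz => ?_
  have hz0 : aeval z p = 0 := by
    rw [← eval_map_algebraMap]
    exact (mem_roots'.mp hz).2
  refine ⟨z.re, Complex.ext (by simp) ?_⟩
  rcases lt_trichotomy z.im 0 with h | h | h
  · refine absurd ?_ (hup ((starRingEnd ℂ) z) (by simpa using h))
    rw [aeval_conj, hz0, map_zero]
  · simp [h]
  · exact absurd hz0 (hup z h)

lemma exists_antitone_abs_eq_prod {p : ℝ[X]} (hp : p.Splits) :
    ∃ x : Fin p.natDegree → ℝ,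
      p = C p.leadingCoeff * ∏ i, (X - C (x i)) ∧ Antitone fun i => |x i| := by
  obtain ⟨e, he⟩ : ∃ e : Fin p.natDegree → ℝ, p = C p.leadingCoeff * ∏ i, (X - C (e i)) := by
    obtain ⟨l, hl⟩ : ∃ l : List ℝ, p.roots = l := ⟨_, (Multiset.coe_toList _).symm⟩
    have hlen : l.length = p.natDegree := by
      rw [hp.natDegree_eq_card_roots, hl, Multiset.coe_card]
    refine ⟨fun i => l.get (Fin.cast hlen.symm i), ?_⟩
    conv_lhs => rw [hp.eq_prod_roots]
    rw [hl, Multiset.map_coe, Multiset.prod_coe]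
    congr 1
    conv_lhs => rw [← List.ofFn_get l, List.map_ofFn, List.prod_ofFn]
    exact Fintype.prod_equiv (finCongr hlen) _ _ (fun i => by simp)
  refine ⟨e ∘ Tuple.sort fun i => -|e i|, ?_, fun i j hij => ?_⟩
  · conv_lhs => rw [he]
    congr 1
    exact (Equiv.prod_comp (Tuple.sort fun i => -|e i|) fun i => X - C (e i)).symm
  · simpa using Tuple.monotone_sort (fun i => -|e i|) hij

theorem selfInterlacing_iff_R_maps_upper_to_lower
    (n : ℕ) (hn : 1 ≤ n) (p : Polynomial ℝ)
    (hdeg : p.natDegree = n) (hlead : 0 < p.leadingCoeff) :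
    SelfInterlacingI p ↔
      ((∀ z : ℂ, ¬(Polynomial.aeval z p = 0 ∧ Polynomial.aeval (-z) p = 0)) ∧
        ∀ z : ℂ, 0 < z.im → Polynomial.aeval z p ≠ 0 →
          (((-1 : ℂ) ^ n * Polynomial.aeval (-z) p) / Polynomial.aeval z p).im < 0) := by
  have hp0 : p ≠ 0 := leadingCoeff_ne_zero.mp hlead.ne'
  have ha : (p.leadingCoeff : ℂ) ≠ 0 := by exact_mod_cast hlead.ne'
  subst hdeg
  constructor
  · rintro ⟨x, hfac, hanti, hpos⟩
    have habs : ∀ i, |x i| = (-1 : ℝ) ^ (i : ℕ) * x i := fun i => by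
      rw [← abs_of_pos (hpos i), abs_mul, abs_pow]
      simp
    have hanti' : StrictAnti fun i => |x i| := by simpa only [habs] using hanti
    have hx : ∀ i, 0 < x i * ∏ j ∈ Finset.univ.erase i, (x i ^ 2 - x j ^ 2) := fun i => by
      have h := mul_pos (hpos i) (neg_one_pow_mul_prod_sq_sub_sq_pos hanti' i)
      rwa [mul_mul_mul_comm, ← pow_add, Even.neg_one_pow ⟨_, rfl⟩, one_mul] at h
    refine ⟨?_, fun z hz _ => ?_⟩
    · rintro z ⟨h1, h2⟩
      rw [hfac, aeval_C_mul_prod] at h1 h2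
      obtain ⟨i, -, hi⟩ := Finset.prod_eq_zero_iff.mp ((mul_eq_zero.mp h1).resolve_left ha)
      obtain ⟨j, -, hj⟩ := Finset.prod_eq_zero_iff.mp ((mul_eq_zero.mp h2).resolve_left ha)
      have hij : x i + x j = 0 := by
        have : (x i : ℂ) + x j = 0 := by linear_combination -hi - hj
        exact_mod_cast this
      have he : |x i| = |x j| := by rw [eq_neg_of_add_eq_zero_left hij, abs_neg]
      have hj : i = j := hanti'.injective he
      subst hj
      have := hpos i
      rw [add_self_eq_zero.mp hij] at this
      simp at this
    · have hnum := neg_one_pow_mul_aeval_neg_C_mul_prod p.leadingCoeff x z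
      have hden := aeval_C_mul_prod p.leadingCoeff x z
      rw [← hfac] at hnum hden
      rw [hnum, hden, mul_div_mul_left _ _ ha]
      exact prod_div_prod_im_neg hn hx hz
  · rintro ⟨h1, h2⟩
    set q : ℝ[X] := C ((-1) ^ p.natDegree) * p.comp (-X) with hq
    have hqz : ∀ z : ℂ, aeval z q = (-1) ^ p.natDegree * aeval (-z) p := fun z => by
      simp [hq, aeval_comp]
    have hqx : ∀ t : ℝ, q.eval t = (-1) ^ p.natDegree * p.eval (-t) := fun t => by
      simp [hq]
    have H : ∀ z : ℂ, 0 < z.im → aeval z p ≠ 0 → (aeval z q / aeval z p).im < 0 := by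
      simpa only [hqz] using h2
    have hpq : ∀ z : ℂ, aeval z p = 0 → aeval z q ≠ 0 := fun z hz h => by
      rw [hqz] at h
      exact h1 z ⟨hz, (mul_eq_zero.mp h).resolve_left (by simp)⟩
    obtain ⟨x, hfac, hanti⟩ := exists_antitone_abs_eq_prod (splits_of_maps_upper_to_lower hp0 hpq H)
    have hroot : ∀ i, p.eval (x i) = 0 := fun i => by
      rw [hfac, eval_mul, eval_prod, Finset.prod_eq_zero (Finset.mem_univ i) (by simp), mul_zero]
    have hx : ∀ i, 0 < x i * ∏ j ∈ Finset.univ.erase i, (x i ^ 2 - x j ^ 2) := fun i => by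
      have hqi : q.eval (x i) ≠ 0 := fun h => by
        refine hpq (x i) ?_ ?_
        · exact (aeval_algebraMap_apply_eq_algebraMap_eval (A := ℂ) (x i) p).trans (by simp [hroot])
        · exact (aeval_algebraMap_apply_eq_algebraMap_eval (A := ℂ) (x i) q).trans (by simp [h])
      have h := derivative_mul_pos_of_maps_upper_to_lower hp0 H (hroot i) hqi
      have hd : p.derivative.eval (x i) =
          p.leadingCoeff * ∏ j ∈ Finset.univ.erase i, (x i - x j) := by
        conv_lhs => rw [hfac, ← Finset.mul_prod_erase _ _ (Finset.mem_univ i)]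
        simp [eval_prod]
      have hqe : q.eval (x i) = p.leadingCoeff * ∏ j, (x i + x j) := by
        have := neg_one_pow_mul_aeval_neg_C_mul_prod p.leadingCoeff x (x i)
        rw [← hfac, ← hqz] at this
        have e := aeval_algebraMap_apply_eq_algebraMap_eval (A := ℂ) (x i) q
        simp only [Complex.coe_algebraMap] at e
        rw [e] at this
        exact_mod_cast this
      rw [hd, hqe, prod_add_eq_two_mul_prod_erase] at h
      simp only [sq_sub_sq]
      rw [Finset.prod_mul_distrib]
      refine pos_of_mul_pos_right (a := 2 * p.leadingCoeff ^ 2) ?_ (by positivity)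
      linarith
    have hne : ∀ i j, i ≠ j → |x i| ≠ |x j| := by
      intro i j hij h
      have := hx i
      rw [Finset.prod_eq_zero (Finset.mem_erase.mpr ⟨hij.symm, Finset.mem_univ j⟩)
        (sub_eq_zero.mpr (sq_eq_sq_iff_abs_eq_abs _ _ |>.mpr h))] at this
      simp at this
    have hanti' : StrictAnti fun i => |x i| :=
      hanti.strictAnti_of_injective fun i j h => by_contra fun hij => hne i j hij h
    have hpos : ∀ i : Fin p.natDegree, 0 < (-1 : ℝ) ^ (i : ℕ) * x i := fun i => by
      have h := mul_pos (hx i) (neg_one_pow_mul_prod_sq_sub_sq_pos hanti' i)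
      refine pos_of_mul_pos_left (b := (∏ j ∈ Finset.univ.erase i, (x i ^ 2 - x j ^ 2)) ^ 2) ?_
        (sq_nonneg _)
      linarith
    have habs : ∀ i, |x i| = (-1 : ℝ) ^ (i : ℕ) * x i := fun i => by
      rw [← abs_of_pos (hpos i), abs_mul, abs_pow]
      simp
    exact ⟨x, hfac, by simpa only [habs] using hanti', hpos⟩
end

section
/- Let p be a real polynomial of degree n ≥ 1 with positive leading coefficient, written p(z) = p_e(z²) + z·p_o(z²) with real polynomials p_e, p_o, and let Φ be its associated function, i.e., Φ(u) = p_o(u)/p_e(u) if n is even and Φ(u) = p_e(u)/(u·p_o(u)) if n is odd. Then p is self-interlacing of kind I if and only if (i) the numerator and denominator of Φ (as just defined) are coprime, so that Φ has exactly l = ⌊(n+1)/2⌋ poles, (ii) Im Φ(w) > 0 for every complex w with Im w > 0 at which the denominator is nonzero (Φ maps the open upper half-plane into itself), and (iii) every zero of the denominator of Φ is positive when n is even and nonnegative when n is odd. -/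
open Polynomial

open Finset in
/-- A product whose first `j` factors are negative and whose remaining ones are positive has
the sign of `(-1) ^ j`. -/
theorem neg_one_pow_mul_prod_range_pos {f : ℕ → ℝ} {j l : ℕ} (hjl : j ≤ l)
    (hneg : ∀ k < j, f k < 0) (hpos : ∀ k, j ≤ k → k < l → 0 < f k) :
    0 < (-1 : ℝ) ^ j * ∏ k ∈ range l, f k := by
  rw [← prod_range_mul_prod_Ico f hjl, ← mul_assoc]
  refine mul_pos ?_ (prod_pos fun k hk => ?_)
  · have h := prod_neg (s := range j) (f := f)
    rw [card_range] at h
    rw [← h]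
    exact prod_pos fun k hk => neg_pos.2 (hneg k (mem_range.1 hk))
  · exact hpos k (mem_Ico.1 hk).1 (mem_Ico.1 hk).2

theorem mul_neg_of_alternating_sign {x y : ℝ} (j : ℕ) (hx : 0 < (-1 : ℝ) ^ j * x)
    (hy : 0 < (-1 : ℝ) ^ (j + 1) * y) : x * y < 0 := by
  have h := mul_pos hx hy
  have h1 : ((-1 : ℝ) ^ j) * (-1) ^ j = 1 := by rw [← mul_pow]; simp
  have h2 : (-1 : ℝ) ^ j * x * ((-1 : ℝ) ^ (j + 1) * y) = -(((-1 : ℝ) ^ j) * (-1) ^ j) * (x * y) := by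
    ring
  rw [h2, h1] at h
  linarith

theorem exists_Ioo_eq_zero_of_mul_neg {f : ℝ → ℝ} (hf : Continuous f) {u v : ℝ} (huv : u < v)
    (h : f u * f v < 0) : ∃ x, u < x ∧ x < v ∧ f x = 0 := by
  rcases mul_neg_iff.1 h with ⟨h1, h2⟩ | ⟨h1, h2⟩
  · obtain ⟨x, hx, h0⟩ := intermediate_value_Ioo' huv.le hf.continuousOn ⟨h2, h1⟩
    exact ⟨x, hx.1, hx.2, h0⟩
  · obtain ⟨x, hx, h0⟩ := intermediate_value_Ioo huv.le hf.continuousOn ⟨h1, h2⟩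
    exact ⟨x, hx.1, hx.2, h0⟩

theorem lt_of_forall_succ_lt {f : ℕ → ℝ} {n : ℕ} (h : ∀ i, i + 1 < n → f (i + 1) < f i)
    {i j : ℕ} (hij : i < j) (hj : j < n) : f j < f i := by
  induction j, hij using Nat.le_induction with
  | base => exact h i hj
  | succ k hk ih => exact (h k hj).trans (ih (by omega))

/-- A polynomial with `natDegree` distinct known roots is determined by its leading coefficient. -/
theorem Polynomial.eq_C_leadingCoeff_mul_prod_range {p : ℝ[X]} (hp : p ≠ 0) {r : ℕ → ℝ} {n : ℕ}
    (hn : p.natDegree = n) (hinj : Set.InjOn r (Finset.range n))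
    (hr : ∀ i < n, p.eval (r i) = 0) :
    p = C p.leadingCoeff * ∏ i ∈ Finset.range n, (X - C (r i)) := by
  have hle : (Finset.range n).val.map r ≤ p.roots := by
    rw [Multiset.le_iff_subset]
    · intro x hx
      obtain ⟨i, hi, rfl⟩ := Multiset.mem_map.1 hx
      exact (mem_roots hp).2 (hr i (Finset.mem_range.1 hi))
    · exact Multiset.Nodup.map_on (fun x hx y hy h => hinj hx hy h) (Finset.range n).nodup
  have heq := Multiset.eq_of_le_of_card_le hle (by simpa [hn] using p.card_roots')
  have hcard : p.roots.card = p.natDegree := by rw [← heq]; simp [hn]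
  conv_lhs => rw [← C_leadingCoeff_mul_prod_multiset_X_sub_C hcard, ← heq]
  simp [Finset.prod]

/-- A real polynomial with only real complex roots splits over `ℝ`. -/
theorem Polynomial.splits_of_forall_im_eq_zero {D : ℝ[X]}
    (h : ∀ x : ℂ, aeval x D = 0 → x.im = 0) : D.Splits := by
  refine Splits.of_splits_map (algebraMap ℝ ℂ) (IsAlgClosed.splits _) fun a ha => ?_
  have h0 := isRoot_of_mem_roots ha
  rw [IsRoot, eval_map_algebraMap] at h0
  exact ⟨a.re, Complex.ext (by simp) (by simp [h a h0])⟩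

/-- The real roots of a split separable polynomial, in decreasing order. -/
theorem Polynomial.exists_decreasing_roots {D : ℝ[X]} (hs : D.Splits) (hnd : D.roots.Nodup)
    {l : ℕ} (hl : D.natDegree = l) :
    ∃ ω : ℕ → ℝ, (∀ i j, i < j → j < l → ω j < ω i) ∧ ∀ i < l, D.IsRoot (ω i) := by
  have hc : D.roots.toFinset.card = l := by
    rw [Multiset.toFinset_card_of_nodup hnd, ← hs.natDegree_eq_card_roots, hl]
  refine ⟨fun i => if h : l - 1 - i < l then D.roots.toFinset.orderEmbOfFin hc ⟨l - 1 - i, h⟩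
    else 0, fun i j hij hj => ?_, fun i hi => ?_⟩
  · simp only [show l - 1 - i < l by omega, show l - 1 - j < l by omega, dite_true]
    apply (D.roots.toFinset.orderEmbOfFin hc).strictMono
    simp only [Fin.mk_lt_mk]
    omega
  · simp only [show l - 1 - i < l by omega, dite_true]
    have := D.roots.toFinset.orderEmbOfFin_mem hc ⟨l - 1 - i, by omega⟩
    rw [Multiset.mem_toFinset] at this
    exact isRoot_of_mem_roots this

theorem Polynomial.aeval_complex_ofReal (P : ℝ[X]) (x : ℝ) :
    aeval (x : ℂ) P = ((P.eval x : ℝ) : ℂ) := by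
  rw [← Complex.coe_algebraMap, aeval_algebraMap_apply, coe_aeval_eq_eval]

/-- A pole of a rational function that maps the upper half-plane to itself is simple and has
negative residue. -/
theorem simple_pole_of_im_pos {D N E : ℝ[X]} {a : ℝ} {k : ℕ} (hk : k ≠ 0)
    (hD : D = (X - C a) ^ k * E) (hE : E.eval a ≠ 0) (hN : N.eval a ≠ 0)
    (him : ∀ w : ℂ, 0 < w.im → 0 < (aeval w N / aeval w D).im) :
    k = 1 ∧ N.eval a * E.eval a < 0 := by
  have key : ∀ u : ℂ, 0 < u.im → 0 ≤ (N.eval a / E.eval a) * ((u ^ k)⁻¹).im := by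
    intro u hu
    let F : ℝ → ℂ := fun t => (u ^ k)⁻¹ * (aeval ((a : ℂ) + t * u) N / aeval ((a : ℂ) + t * u) E)
    have hEC : (aeval ((a : ℂ) + (0 : ℝ) * u)) E ≠ 0 := by
      simpa [aeval_complex_ofReal] using hE
    have hcont : ContinuousAt F 0 := by
      refine continuousAt_const.mul (ContinuousAt.div ?_ ?_ hEC)
      · fun_prop
      · fun_prop
    have hF0 : (F 0).im = (N.eval a / E.eval a) * ((u ^ k)⁻¹).im := by
      simp only [F, Complex.ofReal_zero, zero_mul, add_zero, aeval_complex_ofReal,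
        ← Complex.ofReal_div]
      rw [mul_comm, Complex.im_ofReal_mul]
    rw [← hF0]
    refine ge_of_tendsto ((Complex.continuous_im.continuousAt.comp hcont).tendsto.mono_left
      (nhdsWithin_le_nhds (s := Set.Ioi 0))) ?_
    filter_upwards [self_mem_nhdsWithin] with t ht
    have ht : (0 : ℝ) < t := ht
    have h := him ((a : ℂ) + t * u) (by simpa using mul_pos ht hu)
    have h2 : (aeval ((a : ℂ) + t * u) N / aeval ((a : ℂ) + t * u) D)
        = ((t ^ k)⁻¹ : ℝ) * F t := by
      rw [hD]
      simp only [F, map_mul, map_pow, map_sub, aeval_X, aeval_C, Complex.coe_algebraMap,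
        add_sub_cancel_left, mul_pow, Complex.ofReal_inv, Complex.ofReal_pow]
      simp only [div_eq_mul_inv, mul_inv]
      ring
    rw [h2, Complex.im_ofReal_mul] at h
    exact (pos_of_mul_pos_right h (by positivity)).le
  have hA : N.eval a / E.eval a ≠ 0 := div_ne_zero hN hE
  have hdir : ∀ θ : ℝ, 0 < θ → θ < Real.pi → 0 ≤ -(N.eval a / E.eval a) * Real.sin (k * θ) := by
    intro θ h0 h1
    have h := key (Complex.exp (θ * Complex.I))
      (by rw [Complex.exp_ofReal_mul_I_im]; exact Real.sin_pos_of_pos_of_lt_pi h0 h1)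
    have h3 : (Complex.exp (θ * Complex.I) ^ k)⁻¹ = Complex.exp ((-(k * θ) : ℝ) * Complex.I) := by
      rw [← Complex.exp_nat_mul, ← Complex.exp_neg]
      congr 1
      push_cast
      ring
    rw [h3, Complex.exp_ofReal_mul_I_im, Real.sin_neg] at h
    linarith
  have hk1 : (1 : ℝ) ≤ k := by exact_mod_cast Nat.one_le_iff_ne_zero.2 hk
  have hpi := Real.pi_pos
  have hneg : N.eval a / E.eval a < 0 := by
    have h := hdir (Real.pi / (2 * k)) (by positivity)
      (by rw [div_lt_iff₀ (by positivity)]; nlinarith)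
    rw [show k * (Real.pi / (2 * k)) = Real.pi / 2 by field_simp, Real.sin_pi_div_two] at h
    exact lt_of_le_of_ne (by linarith) hA
  refine ⟨?_, ?_⟩
  · by_contra hne
    have hk2 : (2 : ℝ) ≤ k := by exact_mod_cast (by omega : 2 ≤ k)
    have h := hdir (3 * Real.pi / (2 * k)) (by positivity)
      (by rw [div_lt_iff₀ (by positivity)]; nlinarith)
    rw [show k * (3 * Real.pi / (2 * k)) = Real.pi / 2 + Real.pi by field_simp; ring,
      Real.sin_add_pi, Real.sin_pi_div_two] at h
    linarith
  · rcases div_neg_iff.1 hneg with h | h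
    · exact mul_neg_of_pos_of_neg h.1 h.2
    · exact mul_neg_of_neg_of_pos h.1 h.2

theorem neg_one_pow_mul_prod_erase_sub_pos {ω : ℕ → ℝ} {l j : ℕ}
    (hanti : ∀ i j, i < j → j < l → ω j < ω i) (hj : j < l) :
    0 < (-1 : ℝ) ^ j * ∏ k ∈ (Finset.range l).erase j, (ω j - ω k) := by
  have h := neg_one_pow_mul_prod_range_pos (f := fun k => if k = j then 1 else ω j - ω k) hj.le
    (fun k hk => by simpa [hk.ne] using hanti k j hk hj)
    (fun k hk hkl => by
      rcases hk.eq_or_lt with rfl | hk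
      · simp
      · simpa [hk.ne'] using hanti j k hk hkl)
  rw [← Finset.mul_prod_erase _ _ (Finset.mem_range.2 hj), if_pos rfl, one_mul,
    Finset.prod_congr rfl fun k hk => if_neg (Finset.ne_of_mem_erase hk)] at h
  exact h

theorem exists_lt_of_aeval_eq_zero {D : ℝ[X]} {ω : ℕ → ℝ} {l : ℕ} {c : ℝ} (hc : 0 < c)
    (hD : D = C c * ∏ k ∈ Finset.range l, (X - C (ω k))) {x : ℂ} (hx : aeval x D = 0) :
    ∃ k < l, x = (ω k : ℂ) := by
  rw [hD, map_mul, map_prod, aeval_C, mul_eq_zero, Finset.prod_eq_zero_iff] at hx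
  rcases hx with hx | ⟨k, hk, hx⟩
  · exact absurd hx (by simpa using hc.ne')
  · refine ⟨k, Finset.mem_range.1 hk, ?_⟩
    simpa [sub_eq_zero] using hx

theorem isCoprime_of_eval_ne_zero {D N : ℝ[X]} {ω : ℕ → ℝ} {l : ℕ} {c : ℝ} (hc : 0 < c)
    (hD : D = C c * ∏ k ∈ Finset.range l, (X - C (ω k))) (hN : ∀ k < l, N.eval (ω k) ≠ 0) :
    IsCoprime N D := by
  rw [isCoprime_iff_aeval_ne_zero_of_isAlgClosed ℝ ℂ]
  intro x
  by_contra! h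
  obtain ⟨k, hk, rfl⟩ := exists_lt_of_aeval_eq_zero hc hD h.2
  have h1 := h.1
  rw [aeval_complex_ofReal] at h1
  exact hN k hk (by exact_mod_cast h1)

/-- A strictly proper rational function with real simple poles and negative residues maps the
upper half-plane to itself. -/
theorem im_div_pos_of_alternating_sign {D N : ℝ[X]} {ω : ℕ → ℝ} {l : ℕ} {c : ℝ} (hc : 0 < c)
    (hl : 0 < l) (hD : D = C c * ∏ k ∈ Finset.range l, (X - C (ω k)))
    (hdeg : N.degree < l) (hanti : ∀ i j, i < j → j < l → ω j < ω i)
    (hN : ∀ j < l, 0 < (-1 : ℝ) ^ (j + 1) * N.eval (ω j)) {w : ℂ} (hw : 0 < w.im) :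
    0 < (aeval w N / aeval w D).im := by
  have hne : ∀ k, w ≠ (ω k : ℂ) := by
    rintro k rfl
    simp at hw
  have hinj : Set.InjOn (fun k => (ω k : ℂ)) (Finset.range l) := by
    intro i hi j hj hij
    simp only [Complex.ofReal_inj] at hij
    simp only [Finset.coe_range, Set.mem_Iio] at hi hj
    rcases lt_trichotomy i j with h | h | h
    · exact absurd hij (hanti i j h hj).ne'
    · exact h
    · exact absurd hij (hanti j i h hi).ne
  have hint := Lagrange.eq_interpolate (f := N.map (algebraMap ℝ ℂ)) hinj
    (by simpa using hdeg)
  have hval := Lagrange.eval_interpolate_not_at_node (s := Finset.range l)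
    (v := fun k => (ω k : ℂ)) (fun i => eval (ω i : ℂ) (N.map (algebraMap ℝ ℂ)))
    (x := w) (fun i _ => hne i)
  rw [← hint, eval_map_algebraMap] at hval
  have hDw : aeval w D = c * eval w (Lagrange.nodal (Finset.range l) fun k => (ω k : ℂ)) := by
    rw [hD, Lagrange.eval_nodal]
    simp [map_prod]
  have hnod : eval w (Lagrange.nodal (Finset.range l) fun k => (ω k : ℂ)) ≠ 0 := by
    rw [Lagrange.eval_nodal]
    exact Finset.prod_ne_zero_iff.2 fun k _ => sub_ne_zero.2 (hne k)
  have hc' : (c : ℂ) ≠ 0 := by exact_mod_cast hc.ne'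
  rw [hval, hDw, mul_comm (c : ℂ), mul_div_mul_left _ _ hnod, Complex.div_ofReal_im,
    Complex.im_sum]
  refine div_pos (Finset.sum_pos (fun i hi => ?_) ⟨0, Finset.mem_range.2 hl⟩) hc
  have hi' := Finset.mem_range.1 hi
  set W := ∏ k ∈ (Finset.range l).erase i, (ω i - ω k) with hW
  have hweight : Lagrange.nodalWeight (Finset.range l) (fun k => (ω k : ℂ)) i = ((W⁻¹ : ℝ) : ℂ) := by
    simp [Lagrange.nodalWeight, hW]
  have hneg := mul_neg_of_alternating_sign i
    (neg_one_pow_mul_prod_erase_sub_pos hanti hi') (hN i hi')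
  rw [← hW] at hneg
  have hW0 : W ≠ 0 := left_ne_zero_of_mul hneg.ne
  rw [hweight, eval_map_algebraMap, aeval_complex_ofReal, mul_right_comm, ← Complex.ofReal_mul,
    Complex.im_ofReal_mul, Complex.inv_im]
  have h1 : W⁻¹ * N.eval (ω i) < 0 := by
    have : W⁻¹ * N.eval (ω i) = (W * N.eval (ω i)) * (W⁻¹) ^ 2 := by field_simp
    rw [this]
    exact mul_neg_of_neg_of_pos hneg (by positivity)
  refine mul_pos_of_neg_of_neg h1 (div_neg_of_neg_of_pos ?_ ?_)
  · simpa using hw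
  · exact Complex.normSq_pos.2 (sub_ne_zero.2 (hne i))

/-- Splitting a product over `range n` into its even and odd indexed factors. -/
theorem prod_range_even_odd {M : Type*} [CommMonoid M] (f : ℕ → M) (n : ℕ) :
    ∏ i ∈ Finset.range n, f i = (∏ k ∈ Finset.range ((n + 1) / 2), f (2 * k)) *
      ∏ k ∈ Finset.range (n / 2), f (2 * k + 1) := by
  induction n with
  | zero => simp
  | succ n ih =>
    rw [Finset.prod_range_succ, ih]
    rcases Nat.even_or_odd' n with ⟨m, rfl | rfl⟩
    · rw [show (2 * m + 1) / 2 = m by omega, show 2 * m / 2 = m by omega,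
        show (2 * m + 1 + 1) / 2 = m + 1 by omega, Finset.prod_range_succ, mul_right_comm]
    · rw [show (2 * m + 1 + 1) / 2 = m + 1 by omega, show (2 * m + 1) / 2 = m by omega,
        show (2 * m + 1 + 1 + 1) / 2 = m + 1 by omega,
        Finset.prod_range_succ (fun k => f (2 * k + 1)), mul_assoc]

/-- For `x ≥ 0` (`x > 0` if `n` is even), the values `D (x²)` and `N (x²)` are, up to positive
factors, the sum and the difference of `p x` and `(-1) ^ n * p (-x)`. Here `D` and `N` play the roles of the denominator and the
numerator of the associated function. -/
def IsAssocFraction (n : ℕ) (p D N : ℝ[X]) : Prop :=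
  ∀ x : ℝ, 0 ≤ x → (Even n → 0 < x) → ∃ s t : ℝ, 0 < s ∧ 0 < t ∧
    s * (p.eval x + (-1) ^ n * p.eval (-x)) = 2 * D.eval (x ^ 2) ∧
    p.eval x - (-1) ^ n * p.eval (-x) = 2 * (t * N.eval (x ^ 2))

theorem exists_alternating_of_selfInterlacingI {n : ℕ} {p D N : ℝ[X]} {μ : ℕ → ℝ} {c : ℝ}
    (hc : 0 < c) (hμ : ∀ i j, i < j → j < n → μ j < μ i) (hμ0 : ∀ i < n, 0 < μ i)
    (hp : ∀ x, p.eval x = c * ∏ i ∈ Finset.range n, (x - (-1) ^ i * μ i))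
    (hrel : IsAssocFraction n p D N) :
    ∃ ω : ℕ → ℝ, (∀ i j, i < j → j < (n + 1) / 2 → ω j < ω i) ∧
      (∀ j < (n + 1) / 2, 0 ≤ ω j ∧ (Even n → 0 < ω j)) ∧
      (∀ j < (n + 1) / 2, D.eval (ω j) = 0) ∧
      ∀ j < (n + 1) / 2, 0 < (-1 : ℝ) ^ (j + 1) * N.eval (ω j) := by
  have hp1 : ∀ x, p.eval x = c * ((∏ k ∈ Finset.range ((n + 1) / 2), (x - μ (2 * k))) *
      ∏ k ∈ Finset.range (n / 2), (x + μ (2 * k + 1))) := by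
    intro x
    rw [hp, prod_range_even_odd]
    simp [pow_succ]
  have hp2 : ∀ x, (-1) ^ n * p.eval (-x) =
      c * ((∏ k ∈ Finset.range (n / 2), (x - μ (2 * k + 1))) *
        ∏ k ∈ Finset.range ((n + 1) / 2), (x + μ (2 * k))) := by
    intro x
    have h : ∏ i ∈ Finset.range n, (x + (-1) ^ i * μ i) =
        (-1) ^ n * ∏ i ∈ Finset.range n, (-x - (-1) ^ i * μ i) := by
      have h := Finset.prod_neg (s := Finset.range n) (f := fun i => -x - (-1) ^ i * μ i)
      rw [Finset.card_range] at h
      rw [← h]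
      exact Finset.prod_congr rfl fun i _ => by ring
    rw [hp, mul_left_comm, ← h, prod_range_even_odd, mul_comm (∏ k ∈ Finset.range (n / 2), _)]
    simp [pow_succ, sub_eq_add_neg]
  have hpsign : ∀ x j, 0 ≤ x → j ≤ (n + 1) / 2 → (∀ k < j, x < μ (2 * k)) →
      (∀ k, j ≤ k → k < (n + 1) / 2 → μ (2 * k) < x) → 0 < (-1 : ℝ) ^ j * p.eval x := by
    intro x j hx hj h1 h2
    rw [hp1, mul_left_comm, ← mul_assoc ((-1 : ℝ) ^ j)]
    refine mul_pos hc (mul_pos (neg_one_pow_mul_prod_range_pos hj (fun k hk => ?_)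
      fun k hk hkl => ?_) (Finset.prod_pos fun k hk => ?_))
    · linarith [h1 k hk]
    · linarith [h2 k hk hkl]
    · have := Finset.mem_range.1 hk
      linarith [hμ0 (2 * k + 1) (by omega)]
  have hz : ∀ j, j < (n + 1) / 2 → ∃ z, 0 ≤ z ∧ (Even n → 0 < z) ∧ z < μ (2 * j) ∧
      (2 * j + 1 < n → μ (2 * j + 1) ≤ z) ∧ p.eval z + (-1) ^ n * p.eval (-z) = 0 := by
    intro j hj
    by_cases hjn : 2 * j + 1 < n
    · have hj1 : 2 * j < n := by omega
      have ha : 0 < (-1 : ℝ) ^ j * (p.eval (μ (2 * j)) + (-1) ^ n * p.eval (-μ (2 * j))) := by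
        rw [hp2, hp1, Finset.prod_eq_zero (Finset.mem_range.2 hj) (sub_self _), zero_mul, mul_zero,
          zero_add, mul_left_comm, ← mul_assoc ((-1 : ℝ) ^ j)]
        refine mul_pos hc (mul_pos (neg_one_pow_mul_prod_range_pos (by omega) (fun k hk => ?_)
          fun k hk hkl => ?_) (Finset.prod_pos fun k hk => ?_))
        · linarith [hμ (2 * k + 1) (2 * j) (by omega) hj1]
        · linarith [hμ (2 * j) (2 * k + 1) (by omega) (by omega)]
        · have := Finset.mem_range.1 hk
          linarith [hμ0 (2 * k) (by omega), hμ0 (2 * j) hj1]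
      have hb : 0 < (-1 : ℝ) ^ (j + 1) *
          (p.eval (μ (2 * j + 1)) + (-1) ^ n * p.eval (-μ (2 * j + 1))) := by
        rw [hp2, Finset.prod_eq_zero (Finset.mem_range.2 (by omega : j < n / 2)) (sub_self _),
          zero_mul, mul_zero, add_zero]
        refine hpsign _ _ (hμ0 _ hjn).le (by omega) (fun k hk => ?_)
          fun k hk hkl => ?_
        · exact hμ (2 * k) (2 * j + 1) (by omega) hjn
        · exact hμ (2 * j + 1) (2 * k) (by omega) (by omega)
      have hmul := mul_neg_of_alternating_sign j ha hb
      rw [mul_comm] at hmul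
      obtain ⟨z, hz1, hz2, hz3⟩ := exists_Ioo_eq_zero_of_mul_neg
        (f := fun x => p.eval x + (-1) ^ n * p.eval (-x)) (by fun_prop)
        (hμ (2 * j) (2 * j + 1) (by omega) hjn) hmul
      have := hμ0 _ hjn
      exact ⟨z, by linarith, fun _ => by linarith, hz2, fun _ => hz1.le, hz3⟩
    · have hodd : Odd n := ⟨j, by omega⟩
      refine ⟨0, le_rfl, fun h => absurd h (Nat.not_even_iff_odd.2 hodd), hμ0 _ (by omega),
        fun h => absurd h hjn, ?_⟩
      simp [hodd.neg_one_pow]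
  choose! z hz0 hzpos hzlt hzge hzero using hz
  refine ⟨fun j => z j ^ 2, fun i j hij hj => ?_, fun j hj => ⟨sq_nonneg _, fun he =>
    pow_pos (hzpos j hj he) 2⟩, fun j hj => ?_, fun j hj => ?_⟩
  · refine pow_lt_pow_left₀ ?_ (hz0 j hj) two_ne_zero
    exact (hzlt j hj).trans ((hμ (2 * i + 1) (2 * j) (by omega) (by omega)).trans_le
      (hzge i (by omega) (by omega)))
  · obtain ⟨s, t, -, -, h, -⟩ := hrel (z j) (hz0 j hj) (hzpos j hj)
    rw [hzero j hj] at h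
    linarith
  · obtain ⟨s, t, -, ht, -, h⟩ := hrel (z j) (hz0 j hj) (hzpos j hj)
    have h0 := hzero j hj
    have hs := hpsign (z j) (j + 1) (hz0 j hj) (by omega)
      (fun k hk => ?_) (fun k hk hkl => ?_)
    · rw [show p.eval (z j) = t * N.eval (z j ^ 2) by linarith, mul_left_comm] at hs
      exact pos_of_mul_pos_right hs ht.le
    · rcases (Nat.lt_succ_iff.1 hk).eq_or_lt with rfl | hk
      · exact hzlt k hj
      · exact (hzlt j hj).trans (hμ _ _ (by omega) (by omega))
    · exact (hμ (2 * j + 1) (2 * k) (by omega) (by omega)).trans_le (hzge j hj (by omega))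

theorem selfInterlacingI_of_interlacing_roots {p : ℝ[X]} {μ : ℕ → ℝ} (hp : p ≠ 0)
    (hμ : ∀ i, i + 1 < p.natDegree → μ (i + 1) < μ i) (hμ0 : ∀ i < p.natDegree, 0 < μ i)
    (hroot : ∀ i < p.natDegree, p.eval ((-1) ^ i * μ i) = 0) : SelfInterlacingI p := by
  have hanti : ∀ i j, i < j → j < p.natDegree → μ j < μ i :=
    fun i j hij hj => lt_of_forall_succ_lt hμ hij hj
  have hsq : ∀ i : ℕ, (-1 : ℝ) ^ i * ((-1) ^ i * μ i) = μ i := by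
    intro i
    rw [← mul_assoc, ← mul_pow]
    simp
  have habs : ∀ i < p.natDegree, |(-1) ^ i * μ i| = μ i := by
    intro i hi
    rw [abs_mul, abs_pow, abs_neg, abs_one, one_pow, one_mul, abs_of_pos (hμ0 i hi)]
  refine ⟨fun i => (-1) ^ (i : ℕ) * μ i, ?_, fun i j hij => ?_, fun i => ?_⟩
  · rw [Fin.prod_univ_eq_prod_range (fun i => X - C ((-1) ^ i * μ i))]
    refine eq_C_leadingCoeff_mul_prod_range hp rfl (fun i hi j hj hij => ?_) hroot
    simp only [Finset.coe_range, Set.mem_Iio] at hi hj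
    have hij' : μ i = μ j := by rw [← habs i hi, ← habs j hj]; exact congrArg _ hij
    rcases lt_trichotomy i j with h | h | h
    · exact absurd hij' (hanti i j h hj).ne'
    · exact h
    · exact absurd hij' (hanti j i h hi).ne
  · simp only [hsq]
    exact hanti i j hij j.2
  · rw [hsq]
    exact hμ0 i i.2

theorem selfInterlacingI_of_alternating {n : ℕ} {p D N : ℝ[X]} {ω : ℕ → ℝ} {c : ℝ} (hn : 1 ≤ n)
    (hdeg : p.natDegree = n) (hlead : 0 < p.leadingCoeff) (hc : 0 < c)
    (hD : D = C c * ∏ k ∈ Finset.range ((n + 1) / 2), (X - C (ω k)))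
    (hrel : IsAssocFraction n p D N) (hzero : Even n → p.eval 0 = D.eval 0)
    (hanti : ∀ i j, i < j → j < (n + 1) / 2 → ω j < ω i)
    (hω : ∀ j < (n + 1) / 2, 0 ≤ ω j ∧ (Even n → 0 < ω j))
    (hN : ∀ j < (n + 1) / 2, 0 < (-1 : ℝ) ^ (j + 1) * N.eval (ω j)) : SelfInterlacingI p := by
  have hp0 : p ≠ 0 := by
    rintro rfl
    simp at hlead
  have hDsign : ∀ u j, j ≤ (n + 1) / 2 → (∀ k < j, u < ω k) →
      (∀ k, j ≤ k → k < (n + 1) / 2 → ω k < u) → 0 < (-1 : ℝ) ^ j * D.eval u := by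
    intro u j hj h1 h2
    rw [hD]
    simp only [eval_mul, eval_C, eval_prod, eval_sub, eval_X]
    rw [mul_left_comm]
    exact mul_pos hc (neg_one_pow_mul_prod_range_pos hj (fun k hk => sub_neg.2 (h1 k hk))
      fun k hk hkl => sub_pos.2 (h2 k hk hkl))
  have hzpos : ∀ j < (n + 1) / 2, Even n → 0 < √(ω j) :=
    fun j hj he => Real.sqrt_pos.2 ((hω j hj).2 he)
  have hzanti : ∀ i j, i < j → j < (n + 1) / 2 → √(ω j) < √(ω i) :=
    fun i j hij hj => Real.sqrt_lt_sqrt (hω j hj).1 (hanti i j hij hj)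
  have hpz : ∀ j < (n + 1) / 2, 0 < (-1 : ℝ) ^ (j + 1) * p.eval √(ω j) ∧
      p.eval √(ω j) + (-1) ^ n * p.eval (-√(ω j)) = 0 := by
    intro j hj
    obtain ⟨s, t, hs, ht, h1, h2⟩ := hrel _ (Real.sqrt_nonneg (ω j)) (hzpos j hj)
    have hD0 : D.eval (ω j) = 0 := by
      rw [hD]
      simp only [eval_mul, eval_C, eval_prod, eval_sub, eval_X]
      rw [Finset.prod_eq_zero (Finset.mem_range.2 hj) (sub_self _), mul_zero]
    rw [Real.sq_sqrt (hω j hj).1] at h1 h2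
    rw [hD0, mul_zero, mul_eq_zero, or_iff_right hs.ne'] at h1
    refine ⟨?_, h1⟩
    rw [show p.eval √(ω j) = t * N.eval (ω j) by linarith, mul_left_comm]
    exact mul_pos ht (hN j hj)
  have hb : ∀ j, j < n / 2 → ∃ b, 0 < b ∧ b < √(ω j) ∧
      (j + 1 < (n + 1) / 2 → √(ω (j + 1)) < b) ∧ p.eval (-b) = 0 := by
    intro j hj
    obtain ⟨y, hy0, hyz, hy1, hy⟩ : ∃ y, 0 ≤ y ∧ y < √(ω j) ∧
        (j + 1 < (n + 1) / 2 → √(ω (j + 1)) = y) ∧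
        0 < (-1 : ℝ) ^ (j + 1) * ((-1) ^ n * p.eval (-y)) := by
      by_cases hj1 : j + 1 < (n + 1) / 2
      · obtain ⟨h1, h2⟩ := hpz (j + 1) hj1
        refine ⟨_, Real.sqrt_nonneg _, hzanti j (j + 1) (by omega) hj1, fun _ => rfl, ?_⟩
        rw [show (-1) ^ n * p.eval (-√(ω (j + 1))) = -p.eval √(ω (j + 1)) by linarith]
        rw [pow_succ] at h1
        linarith
      · have he : Even n := ⟨j + 1, by omega⟩
        refine ⟨0, le_rfl, hzpos j (by omega) he, fun h => absurd h hj1, ?_⟩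
        rw [he.neg_one_pow, neg_zero, one_mul, hzero he]
        exact hDsign 0 (j + 1) (by omega) (fun k hk => (hω k (by omega)).2 he)
          fun k hk hkl => by omega
    obtain ⟨h1, h2⟩ := hpz j (by omega)
    have hz : 0 < (-1 : ℝ) ^ (j + 2) * ((-1) ^ n * p.eval (-√(ω j))) := by
      rw [show (-1) ^ n * p.eval (-√(ω j)) = -p.eval √(ω j) by linarith]
      rw [pow_succ] at h1 ⊢
      rw [pow_succ]
      linarith
    obtain ⟨b, hb1, hb2, hb3⟩ := exists_Ioo_eq_zero_of_mul_neg
      (f := fun x => (-1) ^ n * p.eval (-x)) (by fun_prop) hyz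
      (mul_neg_of_alternating_sign (j + 1) hy hz)
    refine ⟨b, by linarith, hb2, fun h => by rw [hy1 h]; exact hb1, ?_⟩
    exact (mul_eq_zero.1 hb3).resolve_left (by simp)
  choose! b hb0 hbz hzb hbroot using hb
  have ha : ∀ j, j < (n + 1) / 2 → ∃ a, √(ω j) < a ∧ (∀ i, j = i + 1 → a < b i) ∧
      p.eval a = 0 := by
    intro j hj
    have h1 := (hpz j hj).1
    cases j with
    | zero =>
      have hlim := tendsto_atTop_of_leadingCoeff_nonneg p
        (natDegree_pos_iff_degree_pos.1 (by omega)) hlead.le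
      obtain ⟨M, hM, hM0⟩ := ((hlim.eventually_gt_atTop 0).and
        (Filter.eventually_gt_atTop √(ω 0))).exists
      obtain ⟨a, ha1, -, ha3⟩ := exists_Ioo_eq_zero_of_mul_neg (f := fun x => p.eval x)
        (by fun_prop) hM0 (mul_neg_of_neg_of_pos (by simpa using h1) hM)
      exact ⟨a, ha1, fun i hi => by omega, ha3⟩
    | succ i =>
      have hi : i < n / 2 := by omega
      have hD0 := hDsign (b i ^ 2) (i + 1) (by omega)
        (fun k hk => ?_) (fun k hk hkl => ?_)
      · obtain ⟨s, t, hs, -, h2, -⟩ := hrel (b i) (hb0 i hi).le (fun _ => hb0 i hi)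
        rw [hbroot i hi, mul_zero, add_zero] at h2
        have hpb : 0 < (-1 : ℝ) ^ (i + 1) * p.eval (b i) := by
          refine pos_of_mul_pos_right (a := s) ?_ hs.le
          rw [mul_left_comm, h2]
          linarith
        have hmul := mul_neg_of_alternating_sign (i + 1) hpb h1
        rw [mul_comm] at hmul
        obtain ⟨a, ha1, ha2, ha3⟩ := exists_Ioo_eq_zero_of_mul_neg (f := fun x => p.eval x)
          (by fun_prop) (hzb i hi hj) hmul
        refine ⟨a, ha1, fun i' hi' => ?_, ha3⟩
        obtain rfl : i = i' := by omega
        exact ha2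
      · refine (Real.lt_sqrt (hb0 i hi).le).1 ((hbz i hi).trans_le ?_)
        rcases (Nat.lt_succ_iff.1 hk).eq_or_lt with rfl | hk
        · exact le_rfl
        · exact (hzanti k i hk (by omega)).le
      · refine (Real.sqrt_lt' (hb0 i hi)).1 (lt_of_le_of_lt ?_ (hzb i hi hj))
        rcases hk.eq_or_lt with rfl | hk
        · exact le_rfl
        · exact (hzanti _ k hk hkl).le
  choose! a haz hab haroot using ha
  have ha0 : ∀ j < (n + 1) / 2, 0 < a j := fun j hj => (Real.sqrt_nonneg _).trans_lt (haz j hj)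
  have hμe : ∀ k, (if Even (2 * k) then a (2 * k / 2) else b (2 * k / 2)) = a k := by
    intro k
    rw [if_pos (even_two_mul k), Nat.mul_div_cancel_left _ two_pos]
  have hμo : ∀ k, (if Even (2 * k + 1) then a ((2 * k + 1) / 2) else b ((2 * k + 1) / 2)) = b k := by
    intro k
    rw [if_neg (by simp), show (2 * k + 1) / 2 = k by omega]
  refine selfInterlacingI_of_interlacing_roots (μ := fun i => if Even i then a (i / 2)
    else b (i / 2)) hp0 (fun i hi => ?_) (fun i hi => ?_) (fun i hi => ?_) <;>
  rw [hdeg] at hi <;> rcases Nat.even_or_odd' i with ⟨k, rfl | rfl⟩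
  · rw [hμe, hμo]
    exact (hbz k (by omega)).trans (haz k (by omega))
  · rw [hμo, show 2 * k + 1 + 1 = 2 * (k + 1) by ring, hμe]
    exact hab (k + 1) (by omega) k rfl
  · rw [hμe]
    exact ha0 k (by omega)
  · rw [hμo]
    exact hb0 k (by omega)
  · rw [hμe]
    simpa using haroot k (by omega)
  · rw [hμo]
    simpa [pow_succ] using hbroot k (by omega)

/-- The characterization for any admissible numerator `N` and denominator `D`. -/
theorem selfInterlacingI_iff_of_isAssocFraction {n : ℕ} {p D N : ℝ[X]} (hn : 1 ≤ n)
    (hdeg : p.natDegree = n) (hlead : 0 < p.leadingCoeff) (hDdeg : D.natDegree = (n + 1) / 2)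
    (hDlead : 0 < D.leadingCoeff) (hNdeg : N.degree < ((n + 1) / 2 : ℕ))
    (hrel : IsAssocFraction n p D N) (hzero : Even n → p.eval 0 = D.eval 0) :
    SelfInterlacingI p ↔ IsCoprime N D ∧
      (∀ w : ℂ, 0 < w.im → aeval w D ≠ 0 → 0 < (aeval w N / aeval w D).im) ∧
      ∀ x : ℂ, aeval x D = 0 → x.im = 0 ∧ (if Even n then 0 < x.re else 0 ≤ x.re) := by
  have hD0 : D ≠ 0 := leadingCoeff_ne_zero.1 hDlead.ne'
  have hprod : ∀ ω : ℕ → ℝ, (∀ i j, i < j → j < (n + 1) / 2 → ω j < ω i) →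
      (∀ j < (n + 1) / 2, D.eval (ω j) = 0) →
      D = C D.leadingCoeff * ∏ k ∈ Finset.range ((n + 1) / 2), (X - C (ω k)) := by
    intro ω hanti hroot
    refine eq_C_leadingCoeff_mul_prod_range hD0 hDdeg (fun i hi j hj hij => ?_) hroot
    simp only [Finset.coe_range, Set.mem_Iio] at hi hj
    rcases lt_trichotomy i j with h | h | h
    · exact absurd hij (hanti i j h hj).ne'
    · exact h
    · exact absurd hij (hanti j i h hi).ne
  constructor
  · rintro ⟨lam, hlam, hanti, hpos⟩
    let μ : ℕ → ℝ := fun i => if h : i < p.natDegree then (-1) ^ i * lam ⟨i, h⟩ else 0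
    have hμ : ∀ i : Fin p.natDegree, (-1) ^ (i : ℕ) * μ i = lam i := by
      intro i
      simp only [μ, i.2, dite_true, Fin.eta]
      rw [← mul_assoc, ← mul_pow]
      simp
    obtain ⟨ω, hω, hω0, hroot, hN⟩ := exists_alternating_of_selfInterlacingI (n := n) (p := p)
      (D := D) (N := N) (μ := μ) hlead
      (fun i j hij hj => by
        subst hdeg
        simp only [μ, hj, hij.trans hj, dite_true]
        exact @hanti ⟨i, hij.trans hj⟩ ⟨j, hj⟩ hij)
      (fun i hi => by
        subst hdeg
        simp only [μ, hi, dite_true]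
        exact hpos ⟨i, hi⟩)
      (fun x => by
        subst hdeg
        rw [← Fin.prod_univ_eq_prod_range (fun i => x - (-1) ^ i * μ i)]
        simp only [hμ]
        conv_lhs => rw [hlam]
        simp [eval_prod]) hrel
    have hD := hprod ω hω hroot
    refine ⟨isCoprime_of_eval_ne_zero hDlead hD fun k hk => right_ne_zero_of_mul (hN k hk).ne',
      fun w hw _ => im_div_pos_of_alternating_sign hDlead (by omega) hD hNdeg hω hN hw,
      fun x hx => ?_⟩
    obtain ⟨k, hk, rfl⟩ := exists_lt_of_aeval_eq_zero hDlead hD hx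
    refine ⟨Complex.ofReal_im _, ?_⟩
    rw [Complex.ofReal_re]
    split_ifs with he
    · exact (hω0 k hk).2 he
    · exact (hω0 k hk).1
  · rintro ⟨hcop, him, hzeros⟩
    have him' : ∀ w : ℂ, 0 < w.im → 0 < (aeval w N / aeval w D).im :=
      fun w hw => him w hw fun h => hw.ne' (hzeros w h).1
    have hNne : ∀ x : ℝ, D.eval x = 0 → N.eval x ≠ 0 := by
      intro x hx hNx
      obtain ⟨u, v, huv⟩ := hcop
      have := congrArg (eval x) huv
      simp [hx, hNx] at this
    have hnd : D.roots.Nodup := by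
      rw [Multiset.nodup_iff_count_le_one]
      intro x
      rw [count_roots]
      by_cases hk : rootMultiplicity x D = 0
      · omega
      · obtain ⟨E, hE, hnot⟩ := exists_eq_pow_rootMultiplicity_mul_and_not_dvd D hD0 x
        rw [dvd_iff_isRoot] at hnot
        have hx : D.eval x = 0 := (rootMultiplicity_pos hD0).1 (Nat.pos_of_ne_zero hk)
        exact (simple_pole_of_im_pos hk hE hnot (hNne x hx) him').1.le
    obtain ⟨ω, hω, hroot⟩ := exists_decreasing_roots
      (splits_of_forall_im_eq_zero fun x hx => (hzeros x hx).1) hnd hDdeg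
    have hD := hprod ω hω hroot
    refine selfInterlacingI_of_alternating hn hdeg hlead hDlead hD hrel hzero hω
      (fun j hj => ?_) (fun j hj => ?_)
    · have h := (hzeros (ω j) (by rw [aeval_complex_ofReal]; exact_mod_cast hroot j hj)).2
      rw [Complex.ofReal_re] at h
      split_ifs at h with he
      · exact ⟨h.le, fun _ => h⟩
      · exact ⟨h, fun h' => absurd h' he⟩
    · have hsign := neg_one_pow_mul_prod_erase_sub_pos hω hj
      have hE : D = (X - C (ω j)) ^ 1 *
          (C D.leadingCoeff * ∏ k ∈ (Finset.range ((n + 1) / 2)).erase j, (X - C (ω k))) := by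
        rw [pow_one, mul_left_comm, Finset.mul_prod_erase _ (fun k => X - C (ω k))
          (Finset.mem_range.2 hj)]
        exact hD
      have hEval : eval (ω j)
          (C D.leadingCoeff * ∏ k ∈ (Finset.range ((n + 1) / 2)).erase j, (X - C (ω k))) =
          D.leadingCoeff * ∏ k ∈ (Finset.range ((n + 1) / 2)).erase j, (ω j - ω k) := by
        simp [eval_prod]
      have hneg := (simple_pole_of_im_pos one_ne_zero hE
        (by rw [hEval]; exact mul_ne_zero hDlead.ne' (right_ne_zero_of_mul hsign.ne'))
        (hNne _ (hroot j hj)) him').2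
      rw [hEval, mul_left_comm] at hneg
      have hneg' := neg_of_mul_neg_right hneg hDlead.le
      rcases neg_one_pow_eq_or ℝ j with h | h <;> rw [pow_succ, h] <;> rw [h] at hsign <;> nlinarith

theorem selfInterlacing_iff_assoc_function
    (n : ℕ) (hn : 1 ≤ n) (p pe po : Polynomial ℝ)
    (hdeg : p.natDegree = n) (hlead : 0 < p.leadingCoeff)
    (hparts : p = pe.comp (Polynomial.X ^ 2) + Polynomial.X * po.comp (Polynomial.X ^ 2)) :
    SelfInterlacingI p ↔
      (IsCoprime (if Even n then po else pe) (if Even n then pe else Polynomial.X * po) ∧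
       (∀ w : ℂ, 0 < w.im →
          Polynomial.aeval w (if Even n then pe else Polynomial.X * po) ≠ 0 →
          0 < (Polynomial.aeval w (if Even n then po else pe) /
               Polynomial.aeval w (if Even n then pe else Polynomial.X * po)).im) ∧
       (∀ x : ℂ, Polynomial.aeval x (if Even n then pe else Polynomial.X * po) = 0 →
          x.im = 0 ∧ (if Even n then 0 < x.re else 0 ≤ x.re))) := by
  have heval : ∀ x, p.eval x = pe.eval (x ^ 2) + x * po.eval (x ^ 2) := by
    intro x
    rw [hparts]
    simp [eval_comp]
  have hpe : ∀ k, pe.coeff k = p.coeff (2 * k) := by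
    intro k
    rw [hparts, ← expand_eq_comp_X_pow, ← expand_eq_comp_X_pow, coeff_add, coeff_expand two_pos]
    cases k with
    | zero => simp
    | succ k =>
      rw [show 2 * (k + 1) = 2 * k + 1 + 1 by ring, coeff_X_mul, coeff_expand two_pos,
        if_pos (by omega), if_neg (by omega), add_zero]
      congr 1
      omega
  have hpo : ∀ k, po.coeff k = p.coeff (2 * k + 1) := by
    intro k
    rw [hparts, ← expand_eq_comp_X_pow, ← expand_eq_comp_X_pow, coeff_add, coeff_X_mul,
      coeff_expand two_pos, coeff_expand two_pos, if_neg (by omega), if_pos (by omega), zero_add]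
    congr 1
    omega
  have hcoeff : 0 < p.coeff n := by rwa [← hdeg]
  have hvanish : ∀ k, n < k → p.coeff k = 0 :=
    fun k hk => coeff_eq_zero_of_natDegree_lt (hdeg ▸ hk)
  by_cases he : Even n
  · simp only [if_pos he]
    obtain ⟨m, hm⟩ := he
    have hm2 : (n + 1) / 2 = m := by omega
    have hc : 0 < pe.coeff m := by rwa [hpe, show 2 * m = n by omega]
    have hd : pe.natDegree = m := natDegree_eq_of_le_of_coeff_ne_zero
      (natDegree_le_iff_coeff_eq_zero.2 fun k hk => by rw [hpe, hvanish _ (by omega)]) hc.ne'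
    have h := selfInterlacingI_iff_of_isAssocFraction (D := pe) (N := po) hn hdeg hlead
      (by rw [hd, hm2]) (by rwa [leadingCoeff, hd])
      (by
        rw [hm2, degree_lt_iff_coeff_zero]
        exact fun k hk => by rw [hpo, hvanish _ (by omega)])
      (fun x _ hx => ⟨1, x, one_pos, hx ⟨m, hm⟩, by
        rw [heval, heval, Even.neg_one_pow ⟨m, hm⟩, neg_sq]; ring, by
        rw [heval, heval, Even.neg_one_pow ⟨m, hm⟩, neg_sq]; ring⟩)
      (fun _ => by simp [heval])
    simpa only [if_pos (show Even n from ⟨m, hm⟩)] using h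
  · simp only [if_neg he]
    have ho := Nat.not_even_iff_odd.1 he
    obtain ⟨m, hm⟩ := ho
    have hm2 : (n + 1) / 2 = m + 1 := by omega
    have hc : 0 < po.coeff m := by rwa [hpo, ← hm]
    have hd : po.natDegree = m := natDegree_eq_of_le_of_coeff_ne_zero
      (natDegree_le_iff_coeff_eq_zero.2 fun k hk => by rw [hpo, hvanish _ (by omega)]) hc.ne'
    have hpo0 : po ≠ 0 := by
      rintro rfl
      simp at hc
    have h := selfInterlacingI_iff_of_isAssocFraction (D := X * po) (N := pe) hn hdeg hlead
      (by rw [natDegree_X_mul hpo0, hd, hm2])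
      (by rwa [leadingCoeff_mul, leadingCoeff_X, one_mul, leadingCoeff, hd])
      (by
        rw [hm2, degree_lt_iff_coeff_zero]
        exact fun k hk => by rw [hpe, hvanish _ (by omega)])
      (fun x hx _ => by
        rcases hx.eq_or_lt with rfl | hx
        · exact ⟨1, 1, one_pos, one_pos, by simp [Odd.neg_one_pow ⟨m, hm⟩], by
            simp [heval, Odd.neg_one_pow ⟨m, hm⟩]; ring⟩
        · exact ⟨x, 1, hx, one_pos, by
            rw [heval, heval, Odd.neg_one_pow ⟨m, hm⟩, neg_sq, eval_mul, eval_X]; ring, by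
            rw [heval, heval, Odd.neg_one_pow ⟨m, hm⟩, neg_sq]; ring⟩)
      (fun h => absurd h he)
    simpa only [if_neg he] using h
end

section
/- (Analogue of Hurwitz's criterion.) Let p(z) = a_0 z^n + a_1 z^{n−1} + ⋯ + a_n be a real polynomial of degree n ≥ 1 with a_0 > 0. Then p is self-interlacing of kind I if and only if its Hurwitz minors satisfy (−1)^j Δ_{2j−1}(p) > 0 for j = 1, …, ⌊(n+1)/2⌋ and Δ_{2j}(p) > 0 for j = 1, …, ⌊n/2⌋. -/
open Polynomial

/-- The coefficient `a_m` of `z^(n-m)` in `p` (where `n = p.natDegree`), with the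
convention `a_m = 0` for `m < 0` or `m > n`. -/
noncomputable def aCoeff (p : Polynomial ℝ) (m : ℤ) : ℝ :=
  if 0 ≤ m ∧ m ≤ (p.natDegree : ℤ) then p.coeff (p.natDegree - m.toNat) else 0

/-- The `k`-th Hurwitz minor `Δ_k(p) = det[(a_{2j-i})]` with `i, j` running over `1, …, k`;
`Δ_0(p) = 1` (determinant of the empty matrix). -/
noncomputable def hurwitzMinor (p : Polynomial ℝ) (k : ℕ) : ℝ :=
  Matrix.det (Matrix.of fun i j : Fin k =>
    aCoeff p (2 * ((j : ℤ) + 1) - ((i : ℤ) + 1)))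

/-- `P` splits over `ℝ`, and `s * P' * Q` is negative at every root of `P`. -/
def SignedSplits (s : ℝ) (P Q : ℝ[X]) : Prop :=
  P.Splits ∧ ∀ x, P.eval x = 0 → s * P.derivative.eval x * Q.eval x < 0

lemma SignedSplits.eq_C_mul_nodal {s : ℝ} {P Q : ℝ[X]} (h : SignedSplits s P Q) :
    P = C P.leadingCoeff * Lagrange.nodal P.roots.toFinset id := by
  have hnd : P.roots.Nodup := by
    by_cases hP : P = 0
    · simp [hP]
    refine Multiset.nodup_iff_count_le_one.2 fun x => ?_
    rw [count_roots]
    by_contra! hx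
    obtain ⟨h1, h2⟩ := (one_lt_rootMultiplicity_iff_isRoot hP).1 hx
    have := h.2 x h1
    rw [h2.eq_zero] at this
    simp at this
  conv_lhs => rw [h.1.eq_prod_roots]
  rw [Lagrange.nodal_eq, Finset.prod, Multiset.toFinset_val, hnd.dedup]
  rfl

lemma eval_eq_mul_sum_inv {S : Finset ℝ} {a : ℝ} (ha : a ≠ 0) {P Q : ℝ[X]}
    (hP : P = C a * Lagrange.nodal S id) (hQ : Q.natDegree ≤ S.card)
    {z : ℂ} (hz : aeval z P ≠ 0) :
    aeval z Q = aeval z P * (((Q.coeff S.card / a : ℝ) : ℂ) +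
      ∑ x ∈ S, ((Q.eval x / P.derivative.eval x : ℝ) : ℂ) * (z - x)⁻¹) := by
  have hmonic : (Lagrange.nodal S (id : ℝ → ℝ)).Monic := Lagrange.nodal_monic
  have hdeg : (Lagrange.nodal S (id : ℝ → ℝ)).natDegree = S.card := Lagrange.natDegree_nodal
  set e := Q.coeff S.card / a with he
  set T := Q - C e * P with hT
  have hPS : ∀ x ∈ S, P.eval x = 0 := fun x hx => by
    rw [hP, eval_mul, show eval x (Lagrange.nodal S id) = 0 from
      Lagrange.eval_nodal_at_node (v := id) hx, mul_zero]
  have hTdeg : T.degree < S.card := by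
    rw [degree_lt_iff_coeff_zero]
    intro m hm
    have hPc : P.coeff m = a * (Lagrange.nodal S (id : ℝ → ℝ)).coeff m := by
      rw [hP, coeff_C_mul]
    rw [hT, coeff_sub, coeff_C_mul, hPc]
    rcases hm.eq_or_lt with rfl | hm
    · have : (Lagrange.nodal S (id : ℝ → ℝ)).coeff S.card = 1 := by
        rw [← hdeg]; exact hmonic
      rw [this, he]; field_simp; ring
    · rw [coeff_eq_zero_of_natDegree_lt (hQ.trans_lt hm),
        coeff_eq_zero_of_natDegree_lt (by rw [hdeg]; exact hm)]
      ring
  have hnod : (Lagrange.nodal S (id : ℝ → ℝ)).map (algebraMap ℝ ℂ) =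
      Lagrange.nodal S (fun x : ℝ => (x : ℂ)) := by
    simp [Lagrange.nodal, Polynomial.map_prod]
  have hinj : Set.InjOn (fun x : ℝ => (x : ℂ)) S := Complex.ofReal_injective.injOn
  have hTC : (T.map (algebraMap ℝ ℂ)).degree < S.card := by rwa [degree_map]
  have hzS : ∀ x ∈ S, z ≠ (x : ℂ) := by
    rintro x hx rfl
    apply hz
    rw [← Complex.coe_algebraMap, aeval_algebraMap_apply_eq_algebraMap_eval, hPS x hx, map_zero]
  have hPz : aeval z P = a * eval z (Lagrange.nodal S (fun x : ℝ => (x : ℂ))) := by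
    rw [← hnod, hP, map_mul, aeval_C, eval_map_algebraMap]; rfl
  have key := congrArg (eval z) (Lagrange.eq_interpolate hinj hTC)
  rw [Lagrange.eval_interpolate_not_at_node _ hzS, eval_map_algebraMap, hT, map_sub, map_mul,
    aeval_C, sub_eq_iff_eq_add] at key
  rw [key, mul_add, hPz, Finset.mul_sum, Finset.mul_sum, add_comm]
  congr 1
  · simp only [Complex.coe_algebraMap]; ring
  · refine Finset.sum_congr rfl fun x hx => ?_
    rw [Lagrange.nodalWeight_eq_eval_derivative_nodal hx, ← hnod, derivative_map]
    have h1 : ∀ R : ℝ[X], eval (x : ℂ) (R.map (algebraMap ℝ ℂ)) = (eval x R : ℝ) := fun R => by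
      rw [← Complex.coe_algebraMap, eval_map_apply]
    rw [h1, h1, hnod]
    have h2 : eval x (Q - C e * P) = eval x Q := by simp [hPS x hx]
    have h3 : eval x P.derivative = a * eval x (derivative (Lagrange.nodal S (id : ℝ → ℝ))) := by
      rw [hP]; simp
    rw [h2, h3]
    push_cast
    have : (a : ℂ) ≠ 0 := by exact_mod_cast ha
    field_simp

lemma SignedSplits.card_roots_toFinset {s : ℝ} {P Q : ℝ[X]} (h : SignedSplits s P Q)
    (hP : P ≠ 0) : P.roots.toFinset.card = P.natDegree := by
  conv_rhs => rw [h.eq_C_mul_nodal]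
  rw [natDegree_C_mul (leadingCoeff_ne_zero.2 hP), Lagrange.natDegree_nodal]

lemma SignedSplits.aeval_eq {s : ℝ} {P Q : ℝ[X]} (h : SignedSplits s P Q)
    (hP : P ≠ 0) (hQ : Q.natDegree ≤ P.natDegree) {z : ℂ} (hz : aeval z P ≠ 0) :
    aeval z Q = aeval z P * (((Q.coeff P.natDegree / P.leadingCoeff : ℝ) : ℂ) +
      ∑ x ∈ P.roots.toFinset,
        ((Q.eval x / P.derivative.eval x : ℝ) : ℂ) * (z - x)⁻¹) := by
  have hc := h.card_roots_toFinset hP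
  have := eval_eq_mul_sum_inv (leadingCoeff_ne_zero.2 hP) h.eq_C_mul_nodal (hQ.trans_eq hc.symm) hz
  rwa [hc] at this

lemma SignedSplits.eval_eq {s : ℝ} {P Q : ℝ[X]} (h : SignedSplits s P Q)
    (hP : P ≠ 0) (hQ : Q.natDegree ≤ P.natDegree) {y : ℝ} (hy : P.eval y ≠ 0) :
    Q.eval y = P.eval y * (Q.coeff P.natDegree / P.leadingCoeff +
      ∑ x ∈ P.roots.toFinset, Q.eval x / P.derivative.eval x * (y - x)⁻¹) := by
  have h1 : ∀ R : ℝ[X], aeval (y : ℂ) R = (eval y R : ℝ) := fun R => by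
    rw [← Complex.coe_algebraMap, aeval_algebraMap_apply_eq_algebraMap_eval]
  have := h.aeval_eq hP hQ (z := (y : ℂ)) (by rw [h1]; exact_mod_cast hy)
  rw [h1, h1] at this
  exact_mod_cast this

/-- Adding a multiple of `X * Q` to `P` preserves `SignedSplits`, provided that the partial
fraction coefficients of `Q / P` dominate. -/
lemma SignedSplits.add_C_mul_X_mul {s κ : ℝ} {P Q : ℝ[X]} (h : SignedSplits s P Q)
    (hκ : κ ≠ 0) (h0 : P.eval 0 ≠ 0) (hQ : Q.natDegree ≤ P.natDegree)
    (hneg : ∀ z : ℂ, aeval z P ≠ 0 → aeval z Q ≠ 0 →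
      s * (∑ x ∈ P.roots.toFinset, Q.eval x / P.derivative.eval x *
          Complex.normSq ((z - x)⁻¹) + κ * Complex.normSq (aeval z Q / aeval z P)) < 0) :
    SignedSplits s (P + C κ * X * Q) Q := by
  have hP : P ≠ 0 := by rintro rfl; simp at h0
  constructor
  · refine Splits.of_splits_map (algebraMap ℝ ℂ) (IsAlgClosed.splits _) fun z hz => ?_
    by_contra hzr
    have hzim : z.im ≠ 0 := fun him => hzr ⟨z.re, Complex.ext (by simp) (by simp [him])⟩
    have hPz : aeval z P ≠ 0 := by
      intro hz0
      exact hzr (h.1.mem_range_of_isRoot hP (by rwa [IsRoot, eval_map_algebraMap]))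
    have hroot := (mem_roots'.1 hz).2
    rw [IsRoot, eval_map_algebraMap, map_add, map_mul, map_mul, aeval_C, aeval_X,
      Complex.coe_algebraMap] at hroot
    have hQz : aeval z Q ≠ 0 := by
      intro hz0; rw [hz0] at hroot; simp at hroot; exact hPz hroot
    have hn := hneg z hPz hQz
    set R := aeval z Q / aeval z P with hR
    have hRs := hR
    rw [h.aeval_eq hP hQ hPz, mul_div_cancel_left₀ _ hPz] at hRs
    have h1 : (κ : ℂ) * z * R = -1 := by
      rw [hR]; field_simp; linear_combination hroot
    have h2 : (κ : ℂ) * z * (Complex.normSq R : ℂ) = -(starRingEnd ℂ) R := by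
      rw [Complex.normSq_eq_conj_mul_self]; linear_combination (starRingEnd ℂ) R * h1
    have h3 : κ * z.im * Complex.normSq R = R.im := by
      have := congrArg Complex.im h2
      simpa using this
    have h4 : R.im = -z.im * ∑ x ∈ P.roots.toFinset, Q.eval x / P.derivative.eval x *
          Complex.normSq ((z - x)⁻¹) := by
      rw [hRs, Complex.add_im, Complex.im_sum, Complex.ofReal_im, zero_add, Finset.mul_sum]
      refine Finset.sum_congr rfl fun x _ => ?_
      rw [Complex.im_ofReal_mul, Complex.inv_im, Complex.normSq_inv]
      simp only [Complex.sub_im, Complex.ofReal_im, sub_zero]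
      ring
    have h5 : z.im * (∑ x ∈ P.roots.toFinset, Q.eval x / P.derivative.eval x *
          Complex.normSq ((z - x)⁻¹) + κ * Complex.normSq R) = 0 := by
      rw [h4] at h3; linear_combination h3
    rw [(mul_eq_zero.1 h5).resolve_left hzim] at hn
    simp at hn
  · intro y hy
    rw [eval_add, eval_mul, eval_mul, eval_C, eval_X] at hy
    have hPy : P.eval y ≠ 0 := by
      intro hPy
      have h1 := h.2 y hPy
      rw [hPy, zero_add, mul_eq_zero, mul_eq_zero] at hy
      rcases hy with (hy | rfl) | hy
      · exact hκ hy
      · exact h0 hPy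
      · rw [hy] at h1; simp at h1
    have hQy : Q.eval y ≠ 0 := by
      intro h1; rw [h1] at hy; simp at hy; exact hPy hy
    have h1 : ∀ R : ℝ[X], aeval (y : ℂ) R = (eval y R : ℝ) := fun R => by
      rw [← Complex.coe_algebraMap, aeval_algebraMap_apply_eq_algebraMap_eval]
    have hn := hneg y (by rw [h1]; exact_mod_cast hPy) (by rw [h1]; exact_mod_cast hQy)
    rw [h1, h1, ← Complex.ofReal_div, Complex.normSq_ofReal] at hn
    have h2 : ∀ x : ℝ, Complex.normSq (((y : ℂ) - x)⁻¹) = ((y - x) ^ 2)⁻¹ := fun x => by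
      rw [← Complex.ofReal_sub, ← Complex.ofReal_inv, Complex.normSq_ofReal, ← mul_inv, sq]
    simp only [h2] at hn
    set α : ℝ → ℝ := fun x => Q.eval x / P.derivative.eval x with hα
    set σ := ∑ x ∈ P.roots.toFinset, α x * ((y - x) ^ 2)⁻¹ with hσ
    set F : ℝ → ℝ := fun w => Q.coeff P.natDegree / P.leadingCoeff +
      ∑ x ∈ P.roots.toFinset, α x * (w - x)⁻¹ with hF
    have hFy : Q.eval y = P.eval y * F y := h.eval_eq hP hQ hPy
    have hFd : HasDerivAt F (-σ) y := by
      have : HasDerivAt F (∑ x ∈ P.roots.toFinset, α x * (-1 / (y - x) ^ 2)) y := by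
        refine HasDerivAt.const_add _ (HasDerivAt.fun_sum fun x hx => ?_)
        refine HasDerivAt.const_mul _ (HasDerivAt.fun_inv ((hasDerivAt_id y).sub_const x) ?_)
        refine sub_ne_zero.2 ?_
        rintro rfl
        exact hPy (mem_roots'.1 (Multiset.mem_toFinset.1 hx)).2
      convert this using 1
      rw [hσ, ← Finset.sum_neg_distrib]
      exact Finset.sum_congr rfl fun x _ => by ring
    have hQd : Q.derivative.eval y = P.derivative.eval y * F y + P.eval y * (-σ) := by
      refine (Q.hasDerivAt y).unique (((P.hasDerivAt y).mul hFd).congr_of_eventuallyEq ?_)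
      filter_upwards [P.continuous.continuousAt.eventually_ne hPy] with w hw
      exact h.eval_eq hP hQ hw
    have hR : Q.eval y / P.eval y = F y := by rw [hFy]; field_simp
    change s * (σ + _) < 0 at hn
    rw [hR] at hn
    have hroot : 1 + κ * y * F y = 0 := by
      have : P.eval y * (1 + κ * y * F y) = 0 := by rw [hFy] at hy; linear_combination hy
      exact (mul_eq_zero.1 this).resolve_left hPy
    have hd : (P + C κ * X * Q).derivative.eval y =
        P.derivative.eval y + κ * Q.eval y + κ * y * Q.derivative.eval y := by
      simp; ring
    have hpos : 0 < P.eval y ^ 2 := by positivity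
    calc s * (P + C κ * X * Q).derivative.eval y * Q.eval y
        = P.eval y ^ 2 * (s * (σ + κ * (F y * F y))) := by
          rw [hd, hQd, hFy]
          linear_combination (s * P.eval y * F y * P.derivative.eval y
            - s * σ * P.eval y ^ 2) * hroot
      _ < 0 := mul_neg_of_pos_of_neg hpos hn

lemma normSq_sum_lt {S : Finset ℝ} {A : ℝ → ℝ} {t : ℝ → ℂ} (hA : ∀ x ∈ S, 0 < A x)
    {u v : ℝ} (hu : u ∈ S) (hv : v ∈ S) (huv : t u ≠ t v) :
    Complex.normSq (∑ x ∈ S, (A x : ℂ) * t x) <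
      (∑ x ∈ S, A x) * ∑ x ∈ S, A x * Complex.normSq (t x) := by
  set W := ∑ x ∈ S, A x with hW
  set T := ∑ x ∈ S, (A x : ℂ) * t x with hT
  have hWpos : 0 < W := Finset.sum_pos hA ⟨u, hu⟩
  have hTre : T.re = ∑ x ∈ S, A x * (t x).re := by simp [hT]
  have hTim : T.im = ∑ x ∈ S, A x * (t x).im := by simp [hT]
  have hvar : ∀ r : ℝ → ℝ, ∑ x ∈ S, A x * (W * r x - ∑ x ∈ S, A x * r x) ^ 2 =
      W * (W * ∑ x ∈ S, A x * r x ^ 2 - (∑ x ∈ S, A x * r x) ^ 2) := by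
    intro r
    set R := ∑ x ∈ S, A x * r x with hR
    have : ∀ x ∈ S, A x * (W * r x - R) ^ 2 =
        W ^ 2 * (A x * r x ^ 2) - 2 * W * R * (A x * r x) + R ^ 2 * A x := fun x _ => by ring
    rw [Finset.sum_congr rfl this, Finset.sum_add_distrib, Finset.sum_sub_distrib,
      ← Finset.mul_sum, ← Finset.mul_sum, ← Finset.mul_sum, ← hR, ← hW]
    ring
  have hpos : 0 < ∑ x ∈ S, A x * Complex.normSq (W * t x - T) := by
    refine Finset.sum_pos' (fun x hx => mul_nonneg (hA x hx).le (Complex.normSq_nonneg _)) ?_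
    by_contra! hcon
    have hz : ∀ x ∈ S, (W : ℂ) * t x = T := fun x hx => by
      have h1 := (hcon x hx)
      have h2 : Complex.normSq (W * t x - T) ≤ 0 := nonpos_of_mul_nonpos_right h1 (hA x hx)
      exact sub_eq_zero.1 (Complex.normSq_eq_zero.1 (h2.antisymm (Complex.normSq_nonneg _)))
    refine huv (mul_left_cancel₀ (a := (W : ℂ)) ?_ ((hz u hu).trans (hz v hv).symm))
    exact_mod_cast hWpos.ne'
  have hsum : ∑ x ∈ S, A x * Complex.normSq (W * t x - T) =
      W * (W * ∑ x ∈ S, A x * Complex.normSq (t x) - Complex.normSq T) := by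
    have h1 := hvar fun x => (t x).re
    have h2 := hvar fun x => (t x).im
    rw [← hTre] at h1
    rw [← hTim] at h2
    have h3 : ∑ x ∈ S, A x * Complex.normSq (t x) =
        ∑ x ∈ S, A x * (t x).re ^ 2 + ∑ x ∈ S, A x * (t x).im ^ 2 := by
      rw [← Finset.sum_add_distrib]
      exact Finset.sum_congr rfl fun x _ => by rw [Complex.normSq_apply]; ring
    have h4 : ∑ x ∈ S, A x * Complex.normSq (W * t x - T) =
        ∑ x ∈ S, A x * (W * (t x).re - T.re) ^ 2 + ∑ x ∈ S, A x * (W * (t x).im - T.im) ^ 2 := by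
      rw [← Finset.sum_add_distrib]
      exact Finset.sum_congr rfl fun x _ => by rw [Complex.normSq_apply]; simp; ring
    rw [h4, h1, h2, h3, Complex.normSq_apply]
    ring
  rw [hsum] at hpos
  linarith [pos_of_mul_pos_right hpos hWpos.le]

lemma SignedSplits.mul_div_neg {s : ℝ} {P Q : ℝ[X]} (h : SignedSplits s P Q) {x : ℝ}
    (hx : P.eval x = 0) : s * (Q.eval x / P.derivative.eval x) < 0 := by
  have h1 := h.2 x hx
  have h2 : P.derivative.eval x ≠ 0 := by intro h0; rw [h0] at h1; simp at h1
  have h3 : s * (Q.eval x / P.derivative.eval x) =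
      s * P.derivative.eval x * Q.eval x / P.derivative.eval x ^ 2 := by field_simp
  rw [h3]
  exact div_neg_of_neg_of_pos h1 (by positivity)

lemma SignedSplits.coeff_eq {s : ℝ} {P Q : ℝ[X]} (h : SignedSplits s P Q) (hP : P ≠ 0)
    (hQ : Q.degree < P.natDegree) :
    Q.coeff (P.natDegree - 1) =
      P.leadingCoeff * ∑ x ∈ P.roots.toFinset, Q.eval x / P.derivative.eval x := by
  have hc := h.card_roots_toFinset hP
  rw [← hc] at hQ ⊢
  rw [Lagrange.coeff_eq_sum (v := id) (Set.injOn_id _) hQ, Finset.mul_sum]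
  refine Finset.sum_congr rfl fun x hx => ?_
  have h1 : P.derivative.eval x = P.leadingCoeff * ∏ j ∈ P.roots.toFinset.erase x, (x - j) := by
    conv_lhs => rw [h.eq_C_mul_nodal]
    rw [derivative_C_mul, eval_C_mul]
    congr 1
    have := Lagrange.eval_nodal_derivative_eval_node_eq (v := (id : ℝ → ℝ)) hx
    rw [Lagrange.eval_nodal] at this
    exact this
  have := leadingCoeff_ne_zero.2 hP
  rw [h1]
  simp only [id]
  field_simp

lemma SignedSplits.coeff_neg {s : ℝ} {P Q : ℝ[X]} (h : SignedSplits s P Q) (hP : 0 < P.natDegree)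
    (hQ : Q.degree < P.natDegree) : s * P.leadingCoeff * Q.coeff (P.natDegree - 1) < 0 := by
  have hP0 : P ≠ 0 := by rintro rfl; simp at hP
  have hne : P.roots.toFinset.Nonempty := by
    rw [← Finset.card_pos, h.card_roots_toFinset hP0]; exact hP
  have h1 : s * P.leadingCoeff * Q.coeff (P.natDegree - 1) = P.leadingCoeff ^ 2 *
      ∑ x ∈ P.roots.toFinset, s * (Q.eval x / P.derivative.eval x) := by
    rw [h.coeff_eq hP0 hQ, ← Finset.mul_sum]; ring
  rw [h1]
  have := leadingCoeff_ne_zero.2 hP0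
  refine mul_neg_of_pos_of_neg (by positivity) (Finset.sum_neg (fun x hx => ?_) hne)
  exact h.mul_div_neg (mem_roots'.1 (Multiset.mem_toFinset.1 hx)).2

/-- Removing the polynomial part of `P / Q` from `P` preserves `SignedSplits`. -/
lemma SignedSplits.sub_C_mul_X_mul {s : ℝ} {P Q : ℝ[X]} (h : SignedSplits s P Q)
    (h0 : P.eval 0 ≠ 0) (hP : 2 ≤ P.natDegree) (hQ : Q.degree < P.natDegree) :
    SignedSplits s (P - C (P.leadingCoeff / Q.coeff (P.natDegree - 1)) * X * Q) Q := by
  have hP0 : P ≠ 0 := by rintro rfl; simp at hP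
  have hneg := h.coeff_neg (by lia) hQ
  set a := P.leadingCoeff with ha
  set b := Q.coeff (P.natDegree - 1) with hb
  set S := P.roots.toFinset with hS
  have hs0 : s ≠ 0 := by rintro rfl; simp at hneg
  have ha0 : a ≠ 0 := leadingCoeff_ne_zero.2 hP0
  have hb0 : b ≠ 0 := by intro hb0; rw [hb0] at hneg; simp at hneg
  have hba : b = a * ∑ x ∈ S, Q.eval x / P.derivative.eval x := h.coeff_eq hP0 hQ
  have hQn : Q.coeff P.natDegree = 0 := coeff_eq_zero_of_degree_lt hQ
  have := h.add_C_mul_X_mul (κ := -(a / b)) (by simp [ha0, hb0]) h0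
    (natDegree_le_of_degree_le hQ.le) fun z hz _ => ?_
  · convert this using 1
    simp only [C_neg]; ring
  · rw [h.aeval_eq hP0 (natDegree_le_of_degree_le hQ.le) hz, mul_div_cancel_left₀ _ hz, hQn]
    simp only [zero_div, Complex.ofReal_zero, zero_add]
    obtain ⟨u, hu, v, hv, huv⟩ := Finset.one_lt_card.1
      (show 1 < S.card by rw [hS, h.card_roots_toFinset hP0]; lia)
    set α : ℝ → ℝ := fun x => Q.eval x / P.derivative.eval x with hα
    have key := normSq_sum_lt (S := S) (A := fun x => -(s * α x)) (t := fun x : ℝ => (z - x)⁻¹)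
      (fun x hx => neg_pos.2 (h.mul_div_neg (mem_roots'.1 (Multiset.mem_toFinset.1 hx)).2)) hu hv
      (by simpa [inv_inj] using huv)
    have e1 : ∑ x ∈ S, ((-(s * α x) : ℝ) : ℂ) * (z - x)⁻¹ =
        ((-s : ℝ) : ℂ) * ∑ x ∈ S, (α x : ℂ) * (z - x)⁻¹ := by
      rw [Finset.mul_sum]; exact Finset.sum_congr rfl fun x _ => by push_cast; ring
    have e2 : ∑ x ∈ S, -(s * α x) = -s * (b / a) := by
      rw [hba, mul_div_cancel_left₀ _ ha0, Finset.mul_sum]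
      exact Finset.sum_congr rfl fun x _ => by ring
    have e3 : ∑ x ∈ S, -(s * α x) * Complex.normSq ((z - x)⁻¹) =
        -s * ∑ x ∈ S, α x * Complex.normSq ((z - x)⁻¹) := by
      rw [Finset.mul_sum]
      exact Finset.sum_congr rfl fun x _ => by ring
    rw [e1, e2, e3, Complex.normSq_mul, Complex.normSq_ofReal] at key
    set N := Complex.normSq (∑ x ∈ S, (α x : ℂ) * (z - x)⁻¹) with hN
    set M := ∑ x ∈ S, α x * Complex.normSq ((z - x)⁻¹) with hM
    change s * (M + -(a / b) * N) < 0
    have hpos : 0 < -(s * a * b) / (s ^ 2 * b ^ 2) := div_pos (by linarith) (by positivity)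
    have e4 : s * (M + -(a / b) * N) =
        (-s * -s * N - -s * (b / a) * (-s * M)) * (-(s * a * b) / (s ^ 2 * b ^ 2)) := by
      field_simp
      ring
    rw [e4]
    exact mul_neg_of_neg_of_pos (by linarith) hpos

lemma SignedSplits.add_C_mul_X_mul_of_neg {s κ : ℝ} {P Q : ℝ[X]} (h : SignedSplits s P Q)
    (hκ : s * κ < 0) (h0 : P.eval 0 ≠ 0) (hQ : Q.natDegree ≤ P.natDegree) :
    SignedSplits s (P + C κ * X * Q) Q := by
  refine h.add_C_mul_X_mul (by rintro rfl; simp at hκ) h0 hQ fun z hz hz' => ?_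
  have h1 : 0 < Complex.normSq (aeval z Q / aeval z P) := by
    rw [Complex.normSq_pos]; exact div_ne_zero hz' hz
  rw [mul_add, Finset.mul_sum, ← mul_assoc]
  refine add_neg_of_nonpos_of_neg (Finset.sum_nonpos fun x hx => ?_) (mul_neg_of_neg_of_pos hκ h1)
  rw [← mul_assoc]
  exact mul_nonpos_of_nonpos_of_nonneg
    (h.mul_div_neg (mem_roots'.1 (Multiset.mem_toFinset.1 hx)).2).le (Complex.normSq_nonneg _)

/-- The part of `p` consisting of the monomials whose degree has parity opposite to that of
`p.natDegree`. -/
noncomputable def oddPart (p : ℝ[X]) : ℝ[X] :=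
  C (1 / 2) * (p - C ((-1) ^ p.natDegree) * p.comp (-X))

lemma oddPart_coeff (p : ℝ[X]) (k : ℕ) :
    (oddPart p).coeff k = if Odd (p.natDegree + k) then p.coeff k else 0 := by
  have h : (p.comp (-X)).coeff k = p.coeff k * (-1) ^ k := by
    rw [show (-X : ℝ[X]) = C (-1) * X by simp, comp_C_mul_X_coeff]
  rw [oddPart, coeff_C_mul, coeff_sub, coeff_C_mul, h]
  have e : (-1 : ℝ) ^ p.natDegree * (p.coeff k * (-1) ^ k) =
      p.coeff k * (-1) ^ (p.natDegree + k) := by ring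
  rw [e]
  split_ifs with hk
  · rw [hk.neg_one_pow]; ring
  · rw [(Nat.not_odd_iff_even.1 hk).neg_one_pow]; ring

lemma degree_oddPart_lt {p : ℝ[X]} : (oddPart p).degree < p.natDegree := by
  rw [degree_lt_iff_coeff_zero]
  intro m hm
  rw [oddPart_coeff]
  rcases hm.eq_or_lt with rfl | hm
  · rw [if_neg (by simp)]
  · rw [coeff_eq_zero_of_natDegree_lt hm, ite_self]

lemma oddPart_coeff_natDegree_sub_one {p : ℝ[X]} (hp : 1 ≤ p.natDegree) :
    (oddPart p).coeff (p.natDegree - 1) = p.coeff (p.natDegree - 1) := by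
  rw [oddPart_coeff, if_pos]
  exact ⟨p.natDegree - 1, by lia⟩

lemma oddPart_eval_of_root {p : ℝ[X]} {x : ℝ} (hx : p.eval x = 0) :
    (oddPart p).eval x = -(1 / 2) * ((-1) ^ p.natDegree * p.eval (-x)) := by
  simp [oddPart, hx]

lemma oddPart_eval_zero {p : ℝ[X]} (hp : p.eval 0 = 0) : (oddPart p).eval 0 = 0 := by
  rw [oddPart_eval_of_root hp]; simp [hp]

/-- One step of Routh's scheme. -/
noncomputable def routhStep (p : ℝ[X]) : ℝ[X] :=
  p - C (p.leadingCoeff / p.coeff (p.natDegree - 1)) * X * oddPart p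

lemma routhStep_eval_zero (p : ℝ[X]) : (routhStep p).eval 0 = p.eval 0 := by
  simp [routhStep]

lemma routhStep_coeff_succ (p : ℝ[X]) (k : ℕ) : (routhStep p).coeff (k + 1) =
    p.coeff (k + 1) - p.leadingCoeff / p.coeff (p.natDegree - 1) * (oddPart p).coeff k := by
  rw [routhStep, coeff_sub, mul_assoc, coeff_C_mul, coeff_X_mul]

lemma routhStep_coeff_zero (p : ℝ[X]) : (routhStep p).coeff 0 = p.coeff 0 := by
  rw [coeff_zero_eq_eval_zero, coeff_zero_eq_eval_zero, routhStep_eval_zero]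

lemma routhStep_coeff_pred {p : ℝ[X]} (hp : 1 ≤ p.natDegree) :
    (routhStep p).coeff (p.natDegree - 1) = p.coeff (p.natDegree - 1) := by
  rcases hn : p.natDegree - 1 with _ | m
  · exact routhStep_coeff_zero p
  · rw [routhStep_coeff_succ, oddPart_coeff, if_neg, mul_zero, sub_zero]
    rw [Nat.not_odd_iff_even]
    exact ⟨m + 1, by lia⟩

lemma natDegree_routhStep {p : ℝ[X]} (hp : 1 ≤ p.natDegree)
    (h : p.coeff (p.natDegree - 1) ≠ 0) : (routhStep p).natDegree = p.natDegree - 1 := by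
  refine natDegree_eq_of_le_of_coeff_ne_zero ?_ (by rwa [routhStep_coeff_pred hp])
  rw [natDegree_le_iff_coeff_eq_zero]
  intro m hm
  obtain ⟨k, rfl⟩ : ∃ k, m = k + 1 := ⟨m - 1, by lia⟩
  rw [routhStep_coeff_succ]
  rcases (show p.natDegree ≤ k + 1 by lia).eq_or_lt with hk | hk
  · have hk' : p.natDegree - 1 = k := by lia
    have := oddPart_coeff_natDegree_sub_one hp
    rw [hk'] at this h ⊢
    rw [this, leadingCoeff, hk]
    field_simp
    ring
  · rw [coeff_eq_zero_of_natDegree_lt hk, oddPart_coeff]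
    split_ifs with ho
    · have : p.natDegree < k := by obtain ⟨r, hr⟩ := ho; lia
      rw [coeff_eq_zero_of_natDegree_lt this]; ring
    · ring

lemma leadingCoeff_routhStep {p : ℝ[X]} (hp : 1 ≤ p.natDegree)
    (h : p.coeff (p.natDegree - 1) ≠ 0) :
    (routhStep p).leadingCoeff = p.coeff (p.natDegree - 1) := by
  rw [leadingCoeff, natDegree_routhStep hp h, routhStep_coeff_pred hp]

lemma oddPart_routhStep {p : ℝ[X]} (hp : 1 ≤ p.natDegree)
    (h : p.coeff (p.natDegree - 1) ≠ 0) : oddPart (routhStep p) = routhStep p - oddPart p := by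
  ext k
  rw [oddPart_coeff, natDegree_routhStep hp h, coeff_sub, oddPart_coeff]
  by_cases hk : Odd (p.natDegree + k)
  · have hk' : ¬ Odd (p.natDegree - 1 + k) := by grind
    rw [if_neg hk', if_pos hk]
    rcases k with _ | k
    · rw [routhStep_coeff_zero]; ring
    · rw [routhStep_coeff_succ, oddPart_coeff, if_neg (by grind)]; ring
  · have hk' : Odd (p.natDegree - 1 + k) := by grind
    rw [if_pos hk', if_neg hk, sub_zero]

lemma signedSplits_routhStep_iff {s : ℝ} {p : ℝ[X]} (hp : 1 ≤ p.natDegree)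
    (h : p.coeff (p.natDegree - 1) ≠ 0) :
    SignedSplits (-s) (routhStep p) (oddPart (routhStep p)) ↔
      SignedSplits s (routhStep p) (oddPart p) := by
  rw [oddPart_routhStep hp h]
  refine and_congr_right fun _ => forall₂_congr fun x hx => ?_
  rw [eval_sub, hx]
  ring_nf

lemma SignedSplits.eval_zero_ne {s : ℝ} {p : ℝ[X]} (h : SignedSplits s p (oddPart p)) :
    p.eval 0 ≠ 0 := fun h0 => by
  have := h.2 0 h0
  rw [oddPart_eval_zero h0] at this
  simp at this

lemma signedSplits_of_natDegree_eq_zero {s : ℝ} {P : ℝ[X]} (hP : P ≠ 0) (hd : P.natDegree = 0)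
    (Q : ℝ[X]) : SignedSplits s P Q := by
  refine ⟨Splits.of_natDegree_le_one (by lia), fun x hx => ?_⟩
  rw [eq_C_of_natDegree_eq_zero hd, eval_C] at hx
  rw [eq_C_of_natDegree_eq_zero hd, hx, C_0] at hP
  exact absurd rfl hP

lemma signedSplits_iff_routhStep {s : ℝ} {p : ℝ[X]} (hp : 1 ≤ p.natDegree) :
    SignedSplits s p (oddPart p) ↔ s * p.leadingCoeff * p.coeff (p.natDegree - 1) < 0 ∧
      SignedSplits (-s) (routhStep p) (oddPart (routhStep p)) := by
  constructor
  · intro h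
    have hneg := h.coeff_neg hp degree_oddPart_lt
    rw [oddPart_coeff_natDegree_sub_one hp] at hneg
    have hb : p.coeff (p.natDegree - 1) ≠ 0 := by rintro hb; rw [hb] at hneg; simp at hneg
    refine ⟨hneg, (signedSplits_routhStep_iff hp hb).2 ?_⟩
    rcases hp.eq_or_lt with hp1 | hp2
    · refine signedSplits_of_natDegree_eq_zero (fun h0 => hb ?_) ?_ _
      · rw [← routhStep_coeff_pred hp, h0, coeff_zero]
      · rw [natDegree_routhStep hp hb, ← hp1]
    · have := h.sub_C_mul_X_mul h.eval_zero_ne hp2 degree_oddPart_lt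
      rwa [oddPart_coeff_natDegree_sub_one hp] at this
  · rintro ⟨hneg, h⟩
    have hb : p.coeff (p.natDegree - 1) ≠ 0 := by rintro hb; rw [hb] at hneg; simp at hneg
    rw [signedSplits_routhStep_iff hp hb] at h
    have h0 : (routhStep p).eval 0 ≠ 0 := fun h0 => by
      have := h.2 0 h0
      rw [oddPart_eval_zero (by rwa [← routhStep_eval_zero])] at this
      simp at this
    have hdeg : (oddPart p).natDegree ≤ (routhStep p).natDegree := by
      rw [natDegree_routhStep hp hb]
      rcases eq_or_ne (oddPart p) 0 with h0 | h0
      · simp [h0]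
      · have := (natDegree_lt_iff_degree_lt h0).2 degree_oddPart_lt
        lia
    have key := h.add_C_mul_X_mul_of_neg (κ := p.leadingCoeff / p.coeff (p.natDegree - 1)) ?_ h0 hdeg
    · convert key using 1
      rw [routhStep]; ring
    · have e : s * (p.leadingCoeff / p.coeff (p.natDegree - 1)) =
        s * p.leadingCoeff * p.coeff (p.natDegree - 1) / p.coeff (p.natDegree - 1) ^ 2 := by
        field_simp
      rw [e]
      exact div_neg_of_neg_of_pos hneg (by positivity)

lemma aCoeff_of_neg (p : ℝ[X]) {m : ℤ} (hm : m < 0) : aCoeff p m = 0 :=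
  if_neg (by lia)

lemma aCoeff_natCast (p : ℝ[X]) (m : ℕ) :
    aCoeff p m = if m ≤ p.natDegree then p.coeff (p.natDegree - m) else 0 := by
  simp [aCoeff]

lemma aCoeff_zero (p : ℝ[X]) : aCoeff p 0 = p.leadingCoeff := by
  simp [aCoeff]

lemma aCoeff_one {p : ℝ[X]} (hp : 1 ≤ p.natDegree) :
    aCoeff p 1 = p.coeff (p.natDegree - 1) := by
  have := aCoeff_natCast p 1
  rwa [if_pos hp] at this

lemma aCoeff_routhStep {p : ℝ[X]} (hp : 1 ≤ p.natDegree)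
    (h : p.coeff (p.natDegree - 1) ≠ 0) (m : ℤ) :
    aCoeff (routhStep p) m = aCoeff p (m + 1) -
      if Odd m then p.leadingCoeff / p.coeff (p.natDegree - 1) * aCoeff p (m + 2) else 0 := by
  rcases lt_or_ge m 0 with hm | hm
  · rw [aCoeff_of_neg _ hm]
    rcases (show m + 1 ≤ 0 by lia).eq_or_lt with hm1 | hm1
    · obtain rfl : m = -1 := by lia
      rw [if_pos (by decide)]
      norm_num
      rw [aCoeff_zero, aCoeff_one hp]
      field_simp
      ring
    · rw [aCoeff_of_neg _ hm1]
      split_ifs with ho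
      · obtain ⟨r, hr⟩ := ho
        rw [aCoeff_of_neg _ (show m + 2 < 0 by lia)]; ring
      · ring
  · lift m to ℕ using hm
    rw [aCoeff_natCast, show (m : ℤ) + 1 = ((m + 1 : ℕ) : ℤ) by simp,
      show (m : ℤ) + 2 = ((m + 2 : ℕ) : ℤ) by simp, aCoeff_natCast, aCoeff_natCast,
      natDegree_routhStep hp h]
    simp only [Int.odd_coe_nat]
    by_cases h1 : m ≤ p.natDegree - 1
    · rw [if_pos h1, if_pos (show m + 1 ≤ p.natDegree by lia)]
      by_cases h2 : m + 2 ≤ p.natDegree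
      · rw [if_pos h2]
        have e1 : p.natDegree - 1 - m = p.natDegree - (m + 2) + 1 := by lia
        have e2 : p.natDegree - (m + 1) = p.natDegree - (m + 2) + 1 := by lia
        rw [e1, e2, routhStep_coeff_succ, oddPart_coeff]
        congr 1
        have e3 : Odd (p.natDegree + (p.natDegree - (m + 2))) ↔ Odd m := by
          obtain ⟨d, hd⟩ := Nat.exists_eq_add_of_le h2
          rw [hd]
          grind
        simp only [e3]
        split_ifs <;> ring
      · rw [if_neg h2, mul_zero, ite_self, sub_zero, show p.natDegree - 1 - m = 0 by lia,
          show p.natDegree - (m + 1) = 0 by lia, routhStep_coeff_zero]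
    · rw [if_neg h1, if_neg (show ¬ m + 1 ≤ p.natDegree by lia),
        if_neg (show ¬ m + 2 ≤ p.natDegree by lia)]
      simp

lemma hurwitzMinor_zero (p : ℝ[X]) : hurwitzMinor p 0 = 1 := by
  simp [hurwitzMinor]

lemma hurwitzMinor_succ {p : ℝ[X]} (hp : 1 ≤ p.natDegree)
    (h : p.coeff (p.natDegree - 1) ≠ 0) (k : ℕ) :
    hurwitzMinor p (k + 1) =
      p.coeff (p.natDegree - 1) * hurwitzMinor (routhStep p) k := by
  set c := p.leadingCoeff / p.coeff (p.natDegree - 1) with hc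
  have hdet := Matrix.det_eq_of_forall_row_eq_smul_add_pred
    (A := Matrix.of fun i j : Fin (k + 1) => aCoeff p (2 * ((j : ℤ) + 1) - ((i : ℤ) + 1)))
    (B := Matrix.of fun i j : Fin (k + 1) => aCoeff p (2 * ((j : ℤ) + 1) - ((i : ℤ) + 1)) -
      if Odd (i : ℕ) then c * aCoeff p (2 * ((j : ℤ) + 1) - (i : ℤ)) else 0)
    (fun i => if Odd (i : ℕ) then 0 else c) (fun j => by simp)
    (fun i j => by
      simp only [Matrix.of_apply, Fin.val_succ, Fin.val_castSucc, Nat.odd_add_one]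
      push_cast
      split_ifs <;> simp_all)
  have hcol : ∀ i : Fin k, aCoeff p (2 * (((0 : Fin (k + 1)) : ℤ) + 1) - ((i.succ : ℤ) + 1)) -
      (if Odd (i.succ : ℕ) then c * aCoeff p (2 * (((0 : Fin (k + 1)) : ℤ) + 1) - (i.succ : ℤ))
        else 0) = 0 := by
    intro i
    simp only [Fin.val_zero, Fin.val_succ]
    push_cast
    rcases Nat.eq_zero_or_pos (i : ℕ) with hi | hi
    · rw [hi]
      norm_num
      rw [aCoeff_zero, aCoeff_one hp, hc]
      field_simp
      ring
    · rw [aCoeff_of_neg _ (by lia)]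
      split_ifs with ho
      · rw [aCoeff_of_neg _ (by obtain ⟨r, hr⟩ := ho; lia)]; ring
      · ring
  rw [hurwitzMinor, hdet, Matrix.det_succ_column_zero, Fin.sum_univ_succ, Finset.sum_eq_zero]
  · rw [add_zero, hurwitzMinor]
    congr 1
    · simp [aCoeff_one hp]
    · congr 1
      ext i j
      simp only [Matrix.submatrix_apply, Matrix.of_apply, Fin.succAbove_zero, Fin.val_succ]
      rw [aCoeff_routhStep hp h, ← hc]
      have e : Odd (2 * ((j : ℤ) + 1) - ((i : ℤ) + 1)) ↔ Odd ((i : ℕ) + 1) := by grind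
      simp only [e]
      push_cast
      ring_nf
  · intro i _
    rw [Matrix.of_apply, hcol i]; ring

/-- Sign conditions on pairs of consecutive Hurwitz minors of the same parity. -/
def HurwitzSigns (s : ℝ) (p : ℝ[X]) : Prop :=
  (1 ≤ p.natDegree → s * p.leadingCoeff * hurwitzMinor p 1 < 0) ∧
    ∀ k, k + 2 ≤ p.natDegree → 0 < (-1) ^ k * s * (hurwitzMinor p (k + 2) * hurwitzMinor p k)

lemma hurwitzMinor_one {p : ℝ[X]} (hp : 1 ≤ p.natDegree) :
    hurwitzMinor p 1 = p.coeff (p.natDegree - 1) := by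
  simp [hurwitzMinor, aCoeff_one hp]

lemma hurwitzSigns_iff_routhStep {s : ℝ} {p : ℝ[X]} (hp : 1 ≤ p.natDegree) :
    HurwitzSigns s p ↔ s * p.leadingCoeff * p.coeff (p.natDegree - 1) < 0 ∧
      HurwitzSigns (-s) (routhStep p) := by
  rw [HurwitzSigns, hurwitzMinor_one hp]
  simp only [hp, forall_const]
  refine and_congr_right fun hneg => ?_
  have hb : p.coeff (p.natDegree - 1) ≠ 0 := by rintro hb; rw [hb] at hneg; simp at hneg
  have hb2 : 0 < p.coeff (p.natDegree - 1) ^ 2 := by positivity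
  rw [HurwitzSigns, natDegree_routhStep hp hb, leadingCoeff_routhStep hp hb]
  have hk0 : 0 < (-1) ^ 0 * s * (hurwitzMinor p (0 + 2) * hurwitzMinor p 0) ↔
      -s * p.coeff (p.natDegree - 1) * hurwitzMinor (routhStep p) 1 < 0 := by
    rw [hurwitzMinor_succ hp hb, hurwitzMinor_zero, ← neg_pos]
    ring_nf
  have hks : ∀ k, 0 < (-1) ^ (k + 1) * s * (hurwitzMinor p (k + 1 + 2) * hurwitzMinor p (k + 1)) ↔
      0 < (-1) ^ k * -s * (hurwitzMinor (routhStep p) (k + 2) * hurwitzMinor (routhStep p) k) := by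
    intro k
    rw [hurwitzMinor_succ hp hb, hurwitzMinor_succ hp hb]
    conv_rhs => rw [← mul_pos_iff_of_pos_left hb2]
    ring_nf
  constructor
  · intro h
    exact ⟨fun h1 => hk0.1 (h 0 (by lia)), fun k hk => (hks k).1 (h (k + 1) (by lia))⟩
  · rintro ⟨h1, h2⟩ (_ | k) hk
    · exact hk0.2 (h1 (by lia))
    · exact (hks k).2 (h2 k (by lia))

lemma signedSplits_iff_hurwitzSigns {n : ℕ} {s : ℝ} {p : ℝ[X]} (hp : p ≠ 0)
    (hn : p.natDegree = n) : SignedSplits s p (oddPart p) ↔ HurwitzSigns s p := by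
  induction n generalizing s p with
  | zero =>
    refine iff_of_true (signedSplits_of_natDegree_eq_zero hp hn _) ⟨fun h => ?_, fun k hk => ?_⟩
    · lia
    · lia
  | succ n ih =>
    have h1 : 1 ≤ p.natDegree := by lia
    rw [signedSplits_iff_routhStep h1, hurwitzSigns_iff_routhStep h1]
    refine and_congr_right fun hneg => ih ?_ ?_
    · intro h0
      rw [← routhStep_coeff_pred h1, h0] at hneg
      simp at hneg
    · rw [natDegree_routhStep h1 (by rintro hb; rw [hb] at hneg; simp at hneg), hn]
      lia

lemma neg_one_pow_mul_prod_pos {n : ℕ} {lam : Fin n → ℝ} (h : StrictAnti fun i => |lam i|)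
    (k : Fin n) : 0 < (-1) ^ (k : ℕ) * ∏ j ∈ Finset.univ.erase k, (lam k ^ 2 - lam j ^ 2) := by
  have e : ∏ j ∈ Finset.univ.erase k, (if j < k then (-1 : ℝ) else 1) = (-1) ^ (k : ℕ) := by
    rw [Finset.prod_ite, Finset.prod_const, Finset.prod_const_one, mul_one]
    congr 1
    rw [← Fin.card_Iio]
    congr 1
    ext j
    simp only [Finset.mem_filter, Finset.mem_erase, Finset.mem_univ, Finset.mem_Iio]
    exact ⟨fun h => h.2, fun h => ⟨⟨h.ne, trivial⟩, h⟩⟩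
  rw [← e, ← Finset.prod_mul_distrib]
  refine Finset.prod_pos fun j hj => ?_
  rcases lt_or_gt_of_ne (Finset.ne_of_mem_erase hj) with hjk | hjk
  · rw [if_pos hjk]
    have := sq_lt_sq.2 (h hjk)
    linarith
  · rw [if_neg hjk.not_gt]
    have := sq_lt_sq.2 (h hjk)
    linarith

lemma derivative_mul_oddPart_eval {p : ℝ[X]} {n : ℕ} (hn : p.natDegree = n) {a : ℝ}
    {lam : Fin n → ℝ} (hp : p = C a * ∏ i, (X - C (lam i))) (k : Fin n) :
    p.derivative.eval (lam k) * (oddPart p).eval (lam k) =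
      -(a ^ 2 * (lam k * ∏ j ∈ Finset.univ.erase k, (lam k ^ 2 - lam j ^ 2))) := by
  have hroot : p.eval (lam k) = 0 := by
    rw [hp, eval_mul, eval_prod, Finset.prod_eq_zero (Finset.mem_univ k) (by simp), mul_zero]
  have h1 : p.derivative.eval (lam k) = a * ∏ j ∈ Finset.univ.erase k, (lam k - lam j) := by
    have := Lagrange.eval_nodal_derivative_eval_node_eq (v := lam) (Finset.mem_univ k)
    rw [Lagrange.eval_nodal] at this
    rw [hp, derivative_C_mul, eval_C_mul, ← this, Lagrange.nodal_eq]
  have h2 : p.eval (-lam k) = a * ((-1) ^ n * ∏ j, (lam k + lam j)) := by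
    have h3 : ((-1 : ℝ)) ^ n = ∏ _j : Fin n, (-1 : ℝ) := by simp
    rw [hp, eval_C_mul, eval_prod, h3, ← Finset.prod_mul_distrib]
    congr 1
    exact Finset.prod_congr rfl fun j _ => by simp; ring
  have h4 : ((-1 : ℝ) ^ n) * (-1) ^ n = 1 := by rw [← mul_pow]; norm_num
  have h5 : ∏ j ∈ Finset.univ.erase k, (lam k ^ 2 - lam j ^ 2) =
      (∏ j ∈ Finset.univ.erase k, (lam k + lam j)) *
        ∏ j ∈ Finset.univ.erase k, (lam k - lam j) := by
    rw [← Finset.prod_mul_distrib]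
    exact Finset.prod_congr rfl fun j _ => by ring
  rw [oddPart_eval_of_root hroot, h1, h2, hn, ← Finset.mul_prod_erase _ _ (Finset.mem_univ k), h5]
  linear_combination (-a ^ 2 * lam k * (∏ j ∈ Finset.univ.erase k, (lam k + lam j)) *
        ∏ j ∈ Finset.univ.erase k, (lam k - lam j)) * h4

lemma sign_iff_of_strictAnti_abs {p : ℝ[X]} {n : ℕ} (hn : p.natDegree = n) {a : ℝ} (ha : a ≠ 0)
    {lam : Fin n → ℝ} (hp : p = C a * ∏ i, (X - C (lam i)))
    (hlam : StrictAnti fun i => |lam i|) (k : Fin n) :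
    1 * p.derivative.eval (lam k) * (oddPart p).eval (lam k) < 0 ↔
      0 < (-1) ^ (k : ℕ) * lam k := by
  have h1 := neg_one_pow_mul_prod_pos hlam k
  set D := ∏ j ∈ Finset.univ.erase k, (lam k ^ 2 - lam j ^ 2) with hD
  have h4 : ((-1 : ℝ) ^ (k : ℕ)) * (-1) ^ (k : ℕ) = 1 := by rw [← mul_pow]; norm_num
  have ha2 : 0 < a ^ 2 := by positivity
  have e : a ^ 2 * (lam k * D) =
      (a ^ 2 * ((-1) ^ (k : ℕ) * D)) * ((-1) ^ (k : ℕ) * lam k) := by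
    linear_combination (-a ^ 2 * lam k * D) * h4
  rw [one_mul, derivative_mul_oddPart_eval hn hp, ← hD, neg_neg_iff_pos, e,
    mul_pos_iff_of_pos_left (mul_pos ha2 h1)]

lemma selfInterlacingI_iff_signedSplits {p : ℝ[X]} (hp : p ≠ 0) :
    SelfInterlacingI p ↔ SignedSplits 1 p (oddPart p) := by
  have ha : p.leadingCoeff ≠ 0 := leadingCoeff_ne_zero.2 hp
  constructor
  · rintro ⟨lam, hprod, hanti, hpos⟩
    have habs : ∀ i, |lam i| = (-1) ^ (i : ℕ) * lam i := fun i => by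
      rw [← abs_of_pos (hpos i), abs_mul, abs_pow, abs_neg, abs_one, one_pow, one_mul]
    have hanti' : StrictAnti fun i => |lam i| := by simpa only [habs] using hanti
    constructor
    · rw [hprod]
      exact (Splits.C _).mul (Splits.prod fun i _ => Splits.X_sub_C _)
    · intro x hx
      rw [hprod, eval_C_mul, eval_prod, mul_eq_zero, Finset.prod_eq_zero_iff] at hx
      obtain ⟨i, _, hi⟩ := hx.resolve_left ha
      rw [eval_sub, eval_X, eval_C, sub_eq_zero] at hi
      rw [hi]
      exact (sign_iff_of_strictAnti_abs rfl ha hprod hanti' i).2 (hpos i)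
  · intro h
    have hroot : ∀ x ∈ p.roots.toFinset, p.eval x = 0 := fun x hx =>
      (mem_roots'.1 (Multiset.mem_toFinset.1 hx)).2
    have hcard := h.card_roots_toFinset hp
    have hinj : Set.InjOn (fun x : ℝ => |x|) p.roots.toFinset := by
      intro x hx y hy hxy
      by_contra hne
      have hyx : y = -x := by
        rcases abs_eq_abs.1 hxy with h1 | h1
        · exact absurd h1 hne
        · rw [h1, neg_neg]
      have h1 := h.2 x (hroot x hx)
      rw [oddPart_eval_of_root (hroot x hx), ← hyx, hroot y hy] at h1
      simp at h1
    have hT : (p.roots.toFinset.image fun x => |x|).card = p.natDegree := by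
      rw [Finset.card_image_of_injOn hinj, hcard]
    have hex : ∀ i : Fin p.natDegree, ∃ x ∈ p.roots.toFinset,
        |x| = (p.roots.toFinset.image fun x => |x|).orderEmbOfFin hT i.rev := fun i =>
      Finset.mem_image.1 (Finset.orderEmbOfFin_mem _ hT i.rev)
    choose lam hlam habs using hex
    have hanti : StrictAnti fun i => |lam i| := fun i j hij => by
      simp only [habs]
      exact (Finset.orderEmbOfFin _ hT).strictMono (Fin.rev_lt_rev.2 hij)
    have hlinj : Function.Injective lam := fun i j hij =>
      hanti.injective (congrArg abs hij)
    have himg : Finset.univ.image lam = p.roots.toFinset := by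
      refine Finset.eq_of_subset_of_card_le (fun x hx => ?_) ?_
      · obtain ⟨i, _, rfl⟩ := Finset.mem_image.1 hx
        exact hlam i
      · rw [Finset.card_image_of_injective _ hlinj, hcard, Finset.card_fin]
    have hprod : p = C p.leadingCoeff * ∏ i, (X - C (lam i)) := by
      conv_lhs => rw [h.eq_C_mul_nodal, Lagrange.nodal_eq, ← himg,
        Finset.prod_image hlinj.injOn]
      simp only [id_eq]
    have hpos : ∀ i : Fin p.natDegree, 0 < (-1) ^ (i : ℕ) * lam i := fun i =>
      (sign_iff_of_strictAnti_abs rfl ha hprod hanti i).1 (h.2 _ (hroot _ (hlam i)))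
    refine ⟨lam, hprod, ?_, hpos⟩
    have habs' : ∀ i : Fin p.natDegree, (-1) ^ (i : ℕ) * lam i = |lam i| := fun i => by
      rw [← abs_of_pos (hpos i), abs_mul, abs_pow, abs_neg, abs_one, one_pow, one_mul]
    simpa only [habs'] using hanti

/-- Analogue of Hurwitz's criterion: `p` of degree `n ≥ 1` with positive leading
coefficient is self-interlacing of kind I iff `(-1)^j Δ_{2j-1}(p) > 0` for
`j = 1, …, ⌊(n+1)/2⌋` and `Δ_{2j}(p) > 0` for `j = 1, …, ⌊n/2⌋`. -/
theorem selfInterlacing_hurwitz_criterion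
    (n : ℕ) (hn : 1 ≤ n) (p : Polynomial ℝ)
    (hdeg : p.natDegree = n) (hlead : 0 < p.leadingCoeff) :
    SelfInterlacingI p ↔
      ((∀ j, 1 ≤ j → j ≤ (n + 1) / 2 → 0 < (-1 : ℝ) ^ j * hurwitzMinor p (2 * j - 1)) ∧
       (∀ j, 1 ≤ j → j ≤ n / 2 → 0 < hurwitzMinor p (2 * j))) := by
  have hp : p ≠ 0 := by rintro rfl; simp at hlead
  rw [selfInterlacingI_iff_signedSplits hp, signedSplits_iff_hurwitzSigns hp rfl, HurwitzSigns,
    hdeg]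
  have hstep : ∀ j, (-1 : ℝ) ^ (2 * j + 1) = -1 := fun j => (odd_two_mul_add_one j).neg_one_pow
  have hsq : ∀ j, ((-1 : ℝ) ^ j) * (-1) ^ j = 1 := fun j => by rw [← mul_pow]; norm_num
  constructor
  · rintro ⟨h1, h2⟩
    have h1 := h1 hn
    constructor
    · intro j hj
      induction j, hj using Nat.le_induction with
      | base =>
        intro _
        have h3 : hurwitzMinor p 1 < 0 := by
          by_contra! h3
          linarith [mul_nonneg hlead.le h3]
        simpa using h3
      | succ j hj ih =>
        intro hjn
        have ih := ih (by lia)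
        have h3 := h2 (2 * j - 1) (by lia)
        obtain ⟨i, rfl⟩ : ∃ i, j = i + 1 := ⟨j - 1, by lia⟩
        rw [show 2 * (i + 1 + 1) - 1 = 2 * i + 3 by lia]
        rw [show 2 * (i + 1) - 1 = 2 * i + 1 by lia] at ih h3
        rw [hstep] at h3
        refine pos_of_mul_pos_left (b := (-1) ^ (i + 1) * hurwitzMinor p (2 * i + 1)) ?_ ih.le
        have e : (-1) ^ (i + 1 + 1) * hurwitzMinor p (2 * i + 3) *
            ((-1) ^ (i + 1) * hurwitzMinor p (2 * i + 1)) =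
            -1 * 1 * (hurwitzMinor p (2 * i + 1 + 2) * hurwitzMinor p (2 * i + 1)) := by
          linear_combination
            (-hurwitzMinor p (2 * i + 3) * hurwitzMinor p (2 * i + 1)) * hsq (i + 1)
        rw [e]; exact h3
    · intro j hj hjn
      have : ∀ j, j ≤ n / 2 → 0 < hurwitzMinor p (2 * j) := by
        intro j
        induction j with
        | zero => intro _; simp [hurwitzMinor_zero]
        | succ j ih =>
          intro hjn
          have h3 := h2 (2 * j) (by lia)
          rw [(even_two_mul j).neg_one_pow, one_mul, one_mul] at h3
          exact pos_of_mul_pos_left h3 (ih (by lia)).le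
      exact this j hjn
  · rintro ⟨h1, h2⟩
    have h2' : ∀ j, j ≤ n / 2 → 0 < hurwitzMinor p (2 * j) := by
      rintro (_ | j) hj
      · simp [hurwitzMinor_zero]
      · exact h2 _ (by lia) hj
    constructor
    · intro _
      have := h1 1 le_rfl (by lia)
      simp only [pow_one, mul_one, Nat.add_one_sub_one] at this
      rw [one_mul]
      exact mul_neg_of_pos_of_neg hlead (by linarith)
    · intro k hk
      rcases Nat.even_or_odd' k with ⟨j, rfl | rfl⟩
      · rw [(even_two_mul j).neg_one_pow, one_mul, one_mul]
        exact mul_pos (h2' (j + 1) (by lia)) (h2' j (by lia))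
      · have h3 := h1 (j + 1) (by lia) (by lia)
        have h4 := h1 (j + 1 + 1) (by lia) (by lia)
        rw [show 2 * (j + 1 + 1) - 1 = 2 * j + 1 + 2 by lia] at h4
        rw [show 2 * (j + 1) - 1 = 2 * j + 1 by lia] at h3
        rw [hstep]
        have h5 := mul_pos h4 h3
        have e : (-1) ^ (j + 1 + 1) * hurwitzMinor p (2 * j + 1 + 2) *
            ((-1) ^ (j + 1) * hurwitzMinor p (2 * j + 1)) =
            -1 * 1 * (hurwitzMinor p (2 * j + 1 + 2) * hurwitzMinor p (2 * j + 1)) := by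
          linear_combination
            (-hurwitzMinor p (2 * j + 1 + 2) * hurwitzMinor p (2 * j + 1)) * hsq (j + 1)
        rwa [e] at h5
end
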